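/- Let A = kQ/I be a gentle one-cycle algebra. If A admits at least one non-projective indecomposable G-projective right A-module (equivalently, the unique cycle of (Q,I) is a full-relational oriented cycle), then A is representation-finite. -/

import Mathlib

/- Common infrastructure: finite quivers, path algebras, gentle algebras,
   right modules, Gorenstein projective modules, etc. -/

open MulOpposite

noncomputable section

/-- A finite quiver, with `nV` vertices and `nE` arrows. -/
structure QuiverData where
  nV : ℕ
  nE : ℕ
  src : Fin nE → Fin nV
  tgt : Fin nE → Fin nV

/-- The relations defining the path algebra `kQ` as a quotient of the free
algebra on the set of vertices and arrows:  the trivial paths `e_v` are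
orthogonal idempotents summing to `1`, and `e_{s(a)} * a = a = a * e_{t(a)}`.
(Paths are composed left-to-right, matching the paper's convention.) -/
inductive PathRel (k : Type) [Field k] (Q : QuiverData) :
    FreeAlgebra k (Fin Q.nV ⊕ Fin Q.nE) → FreeAlgebra k (Fin Q.nV ⊕ Fin Q.nE) → Prop
  | vtx_mul (v w : Fin Q.nV) : PathRel k Q
      (FreeAlgebra.ι k (Sum.inl v) * FreeAlgebra.ι k (Sum.inl w))
      (if v = w then FreeAlgebra.ι k (Sum.inl v) else 0)
  | vtx_sum : PathRel k Q (∑ v : Fin Q.nV, FreeAlgebra.ι k (Sum.inl v)) 1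
  | src_arr (e : Fin Q.nE) : PathRel k Q
      (FreeAlgebra.ι k (Sum.inl (Q.src e)) * FreeAlgebra.ι k (Sum.inr e))
      (FreeAlgebra.ι k (Sum.inr e))
  | arr_tgt (e : Fin Q.nE) : PathRel k Q
      (FreeAlgebra.ι k (Sum.inr e) * FreeAlgebra.ι k (Sum.inl (Q.tgt e)))
      (FreeAlgebra.ι k (Sum.inr e))

/-- The path algebra `kQ`. -/
def PathAlg (k : Type) [Field k] (Q : QuiverData) := RingQuot (PathRel k Q)

instance (k : Type) [Field k] (Q : QuiverData) : Ring (PathAlg k Q) :=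
  inferInstanceAs (Ring (RingQuot (PathRel k Q)))

instance (k : Type) [Field k] (Q : QuiverData) : Algebra k (PathAlg k Q) :=
  inferInstanceAs (Algebra k (RingQuot (PathRel k Q)))

/-- The arrow `e`, as an element of the path algebra. -/
def arr (k : Type) [Field k] (Q : QuiverData) (e : Fin Q.nE) : PathAlg k Q :=
  RingQuot.mkAlgHom k (PathRel k Q) (FreeAlgebra.ι k (Sum.inr e))

/-- The trivial path (idempotent) at the vertex `v`, in the path algebra. -/
def vtx (k : Type) [Field k] (Q : QuiverData) (v : Fin Q.nV) : PathAlg k Q :=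
  RingQuot.mkAlgHom k (PathRel k Q) (FreeAlgebra.ι k (Sum.inl v))

/-- Given a set `Rel` of (composable) pairs of arrows, the relation on `kQ`
identifying each corresponding length-two path with `0`; the quotient is
`kQ/I` where `I` is the two-sided ideal generated by these paths of length two. -/
def GRel (k : Type) [Field k] (Q : QuiverData) (Rel : Set (Fin Q.nE × Fin Q.nE)) :
    PathAlg k Q → PathAlg k Q → Prop := fun x y =>
  (∃ p ∈ Rel, x = arr k Q p.1 * arr k Q p.2) ∧ y = 0

/-- The algebra `A = kQ/I`. -/
def GAlg (k : Type) [Field k] (Q : QuiverData) (Rel : Set (Fin Q.nE × Fin Q.nE)) :=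
  RingQuot (GRel k Q Rel)

instance (k : Type) [Field k] (Q : QuiverData) (Rel : Set (Fin Q.nE × Fin Q.nE)) :
    Ring (GAlg k Q Rel) := inferInstanceAs (Ring (RingQuot (GRel k Q Rel)))

instance (k : Type) [Field k] (Q : QuiverData) (Rel : Set (Fin Q.nE × Fin Q.nE)) :
    Algebra k (GAlg k Q Rel) := inferInstanceAs (Algebra k (RingQuot (GRel k Q Rel)))

/-- The canonical projection `kQ → kQ/I`. -/
def gmap (k : Type) [Field k] (Q : QuiverData) (Rel : Set (Fin Q.nE × Fin Q.nE)) :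
    PathAlg k Q →ₐ[k] GAlg k Q Rel := RingQuot.mkAlgHom k (GRel k Q Rel)

/-- Membership in the ideal `I` (the kernel of `kQ → kQ/I`). -/
def inI (k : Type) [Field k] (Q : QuiverData) (Rel : Set (Fin Q.nE × Fin Q.nE))
    (x : PathAlg k Q) : Prop := gmap k Q Rel x = 0

/-- The idempotent `ε_v ∈ A` at a vertex `v`. -/
def vtxA (k : Type) [Field k] (Q : QuiverData) (Rel : Set (Fin Q.nE × Fin Q.nE))
    (v : Fin Q.nV) : GAlg k Q Rel := gmap k Q Rel (vtx k Q v)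

/-- The image in `A` of an arrow `e`. -/
def arrA (k : Type) [Field k] (Q : QuiverData) (Rel : Set (Fin Q.nE × Fin Q.nE))
    (e : Fin Q.nE) : GAlg k Q Rel := gmap k Q Rel (arr k Q e)

/-- `(Q, I)` is a gentle pair (with `I` the ideal generated by the length-two
paths coming from `Rel`), and moreover `I` is admissible. -/
structure IsGentle (k : Type) [Field k] (Q : QuiverData)
    (Rel : Set (Fin Q.nE × Fin Q.nE)) : Prop where
  /-- the generating relations are composable length-two paths -/
  comp_rel : ∀ p ∈ Rel, Q.tgt p.1 = Q.src p.2
  /-- every vertex is the source of at most two arrows -/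
  src_card : ∀ v, (Finset.univ.filter fun e => Q.src e = v).card ≤ 2
  /-- every vertex is the target of at most two arrows -/
  tgt_card : ∀ v, (Finset.univ.filter fun e => Q.tgt e = v).card ≤ 2
  /-- for each arrow `a` there is at most one arrow `b` with `ab ∉ I` -/
  uniq_nonrel_right : ∀ a b c, ¬ inI k Q Rel (arr k Q a * arr k Q b) →
    ¬ inI k Q Rel (arr k Q a * arr k Q c) → b = c
  /-- for each arrow `a` there is at most one arrow `c` with `ca ∉ I` -/
  uniq_nonrel_left : ∀ a b c, ¬ inI k Q Rel (arr k Q b * arr k Q a) →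
    ¬ inI k Q Rel (arr k Q c * arr k Q a) → b = c
  /-- for each arrow `a` there is at most one (composable) arrow `b` with `ab ∈ I` -/
  uniq_rel_right : ∀ a b c, Q.tgt a = Q.src b → Q.tgt a = Q.src c →
    inI k Q Rel (arr k Q a * arr k Q b) → inI k Q Rel (arr k Q a * arr k Q c) → b = c
  /-- for each arrow `a` there is at most one (composable) arrow `c` with `ca ∈ I` -/
  uniq_rel_left : ∀ a b c, Q.tgt b = Q.src a → Q.tgt c = Q.src a →
    inI k Q Rel (arr k Q b * arr k Q a) → inI k Q Rel (arr k Q c * arr k Q a) → b = c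
  /-- admissibility: some power of the arrow ideal is contained in `I` -/
  admissible : ∃ m, 2 ≤ m ∧ ∀ f : Fin m → Fin Q.nE,
    inI k Q Rel (List.ofFn fun i => arr k Q (f i)).prod

/-- A full-relational oriented cycle `𝒞 = a_1 ⋯ a_len` (of length ≥ 3, as assumed
throughout the paper) in the bound quiver `(Q, I)`, encoded by a periodic
sequence of arrows.  `arrows i` is the arrow `a_{i+1}` (`0`-indexed),
consecutive arrows are composable, all consecutive length-two paths lie in `I`,
and the vertices of the cycle are pairwise distinct. -/
structure FRCycle (k : Type) [Field k] (Q : QuiverData)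
    (Rel : Set (Fin Q.nE × Fin Q.nE)) where
  len : ℕ
  len3 : 3 ≤ len
  arrows : ℕ → Fin Q.nE
  periodic : ∀ i, arrows (i + len) = arrows i
  comp : ∀ i, Q.tgt (arrows i) = Q.src (arrows (i + 1))
  frel : ∀ i, inI k Q Rel (arr k Q (arrows i) * arr k Q (arrows (i + 1)))
  vinj : ∀ i j, i < len → j < len → Q.src (arrows i) = Q.src (arrows j) → i = j

/-- There are no full-relational oriented cycles of length `< 3` (the blanket
assumption of the paper). -/
def NoShortFRC (k : Type) [Field k] (Q : QuiverData)
    (Rel : Set (Fin Q.nE × Fin Q.nE)) : Prop :=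
  ∀ (l : ℕ) (c : ℕ → Fin Q.nE), 1 ≤ l → (∀ i, c (i + l) = c i) →
    (∀ i, Q.tgt (c i) = Q.src (c (i + 1))) →
    (∀ i, inI k Q Rel (arr k Q (c i) * arr k Q (c (i + 1)))) → 3 ≤ l

/-- The set of arrows lying on the cycle. -/
def FRCycle.arrowSet {k : Type} [Field k] {Q : QuiverData}
    {Rel : Set (Fin Q.nE × Fin Q.nE)} (C : FRCycle k Q Rel) : Set (Fin Q.nE) :=
  {a | ∃ i < C.len, C.arrows i = a}

/-- The idempotent `ε_{𝒞,t} ∈ A`: the sum of the `ε_v` over the vertices `v`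
of the cycle `𝒞` other than `s(a_t)` and `t(a_t)`. -/
def epsCt (k : Type) [Field k] (Q : QuiverData) (Rel : Set (Fin Q.nE × Fin Q.nE))
    (C : FRCycle k Q Rel) (t : ℕ) : GAlg k Q Rel :=
  ∑ i ∈ (Finset.range C.len).filter
      (fun i => Q.src (C.arrows i) ≠ Q.src (C.arrows t) ∧
        Q.src (C.arrows i) ≠ Q.tgt (C.arrows t)),
    vtxA k Q Rel (Q.src (C.arrows i))

/-- The relation identifying an element `ε` of a ring with `0`; the quotient is
`R/RεR`. -/
def QuotRel (R : Type) [Ring R] (ε : R) : R → R → Prop := fun x y => x = ε ∧ y = 0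

/-- The quotient ring `R/RεR`. -/
def QuotBy (R : Type) [Ring R] (ε : R) := RingQuot (QuotRel R ε)

instance (R : Type) [Ring R] (ε : R) : Ring (QuotBy R ε) :=
  inferInstanceAs (Ring (RingQuot (QuotRel R ε)))

/-- The canonical projection `R → R/RεR`. -/
def qmap (R : Type) [Ring R] (ε : R) : R →+* QuotBy R ε := RingQuot.mkRingHom (QuotRel R ε)

/-- The right ideal `xR`, as a right `R`-module (i.e. an `Rᵐᵒᵖ`-submodule of `R`). -/
def rIdeal (R : Type) [Ring R] (x : R) : Submodule Rᵐᵒᵖ R := Submodule.span Rᵐᵒᵖ {x}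

/-- Restriction of scalars along `π : R →+* S` turns a right `S`-module into a
right `R`-module. -/
def modRestrict {R S : Type} [Ring R] [Ring S] (π : R →+* S) (M : Type)
    [AddCommGroup M] [Module Sᵐᵒᵖ M] : Module Rᵐᵒᵖ M :=
  Module.compHom M (RingHom.op π)

/-- `M` is a Gorenstein projective right `R`-module:  there is a complete
resolution, i.e. an exact sequence `⋯ → P⁻² → P⁻¹ → P⁰ → P¹ → ⋯` of finitely
generated projective right `R`-modules which stays exact after applying
`Hom_R(-, R)`, with `M ≅ Im(P⁻¹ → P⁰)`. -/
def IsGProjMod (R : Type) [Ring R] (M : Type) [AddCommGroup M] [Module Rᵐᵒᵖ M] : Prop :=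
  ∃ (P : ℤ → ModuleCat.{0} Rᵐᵒᵖ) (d : (n : ℤ) → (P n →ₗ[Rᵐᵒᵖ] P (n + 1))),
    (∀ n, Module.Finite Rᵐᵒᵖ (P n)) ∧
    (∀ n, Module.Projective Rᵐᵒᵖ (P n)) ∧
    (∀ n, LinearMap.range (d n) = LinearMap.ker (d (n + 1))) ∧
    (∀ (n : ℤ) (g : P (n + 1) →ₗ[Rᵐᵒᵖ] R),
      g.comp (d n) = 0 ↔ ∃ h : P (n + 1 + 1) →ₗ[Rᵐᵒᵖ] R, h.comp (d (n + 1)) = g) ∧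
    Nonempty (M ≃ₗ[Rᵐᵒᵖ] LinearMap.range (d (-1)))

/-- `M` is an indecomposable `S`-module. -/
def IsIndec (S : Type) [Ring S] (M : Type) [AddCommGroup M] [Module S M] : Prop :=
  Nontrivial M ∧ ∀ N₁ N₂ : Submodule S M, IsCompl N₁ N₂ → N₁ = ⊥ ∨ N₂ = ⊥

/-- `M` is a non-projective indecomposable Gorenstein projective right `R`-module. -/
def IsNPIGProj (R : Type) [Ring R] (M : Type) [AddCommGroup M] [Module Rᵐᵒᵖ M] : Prop :=
  IsGProjMod R M ∧ IsIndec Rᵐᵒᵖ M ∧ ¬ Module.Projective Rᵐᵒᵖ M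

/-- A right `S`-module `M`, viewed as a right `R`-module along `π : R →+* S`, is a
non-projective indecomposable Gorenstein projective right `R`-module. -/
def RestrIsNPIGProj {R S : Type} [Ring R] [Ring S] (π : R →+* S) (M : Type)
    [AddCommGroup M] [Module Sᵐᵒᵖ M] : Prop :=
  letI := modRestrict π M
  IsNPIGProj R M

/-- The submodule `M·(RεR)` of a right `R`-module `M`;  the quotient
`M ⧸ M·(RεR)` realizes the tensor product `M ⊗_R R/RεR`. -/
def smulIdeal (R : Type) [Ring R] (ε : R) (M : Type) [AddCommGroup M]
    [Module Rᵐᵒᵖ M] : Submodule Rᵐᵒᵖ M :=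
  Submodule.span Rᵐᵒᵖ {m | ∃ (x : M) (a b : R), m = (op (a * ε * b)) • x}

/-- `S` has finitely many finitely generated indecomposable modules up to
isomorphism.  (Applied with `S = Aᵐᵒᵖ` this says `A` is representation-finite.) -/
def RepFinite (S : Type) [Ring S] : Prop :=
  ∃ (n : ℕ) (M : Fin n → ModuleCat.{0} S), ∀ N : ModuleCat.{0} S,
    Module.Finite S N → IsIndec S N → ∃ i, Nonempty (N ≃ₗ[S] M i)

/-- A cycle in the underlying undirected graph of `Q`:  a closed walk of
length ≥ 1 along edges (each traversed forwards or backwards) with pairwise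
distinct vertices and pairwise distinct edges. -/
structure UCycle (Q : QuiverData) where
  len : ℕ
  len1 : 1 ≤ len
  edges : ℕ → Fin Q.nE
  dir : ℕ → Bool
  vert : ℕ → Fin Q.nV
  pe : ∀ i, edges (i + len) = edges i
  pd : ∀ i, dir (i + len) = dir i
  pv : ∀ i, vert (i + len) = vert i
  incid_t : ∀ i, dir i = true →
    Q.src (edges i) = vert i ∧ Q.tgt (edges i) = vert (i + 1)
  incid_f : ∀ i, dir i = false →
    Q.tgt (edges i) = vert i ∧ Q.src (edges i) = vert (i + 1)
  vdist : ∀ i j, i < len → j < len → vert i = vert j → i = j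
  edist : ∀ i j, i < len → j < len → edges i = edges j → i = j

/-- The set of edges of an undirected cycle. -/
def UCycle.edgeSet {Q : QuiverData} (C : UCycle Q) : Set (Fin Q.nE) :=
  {e | ∃ i < C.len, C.edges i = e}

/-- The underlying graph of `Q` has exactly one cycle. -/
def OneCycle (Q : QuiverData) : Prop :=
  Nonempty (UCycle Q) ∧ ∀ C C' : UCycle Q, C.edgeSet = C'.edgeSet

/-- The projective dimension of (the module underlying) `M` is at most `n`. -/
def projDimLE (S : Type) [Ring S] : ℕ → ModuleCat.{0} S → Prop
  | 0, M => Module.Projective S M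
  | n + 1, M => ∃ (P : ModuleCat.{0} S) (f : P →ₗ[S] M), Module.Projective S P ∧
      Function.Surjective f ∧ projDimLE S n (ModuleCat.of S (LinearMap.ker f))

/-- The injective dimension of (the module underlying) `M` is at most `n`. -/
def injDimLE (S : Type) [Ring S] : ℕ → ModuleCat.{0} S → Prop
  | 0, M => Module.Injective S M
  | n + 1, M => ∃ (J : ModuleCat.{0} S) (f : M →ₗ[S] J), Module.Injective S J ∧
      Function.Injective f ∧ injDimLE S n (ModuleCat.of S (J ⧸ LinearMap.range f))

end

section AdaptedBases

variable {k M : Type*} [Field k] [AddCommGroup M] [Module k M]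

/-- The set `B` is a basis of the subspace `W`. -/
def IsBasisOf (B : Set M) (W : Submodule k M) : Prop :=
  LinearIndepOn k id B ∧ Submodule.span k B = W

/-- The subspace `F` is spanned by elements of `B`. -/
def Adapted (B : Set M) (F : Submodule k M) : Prop :=
  F ≤ Submodule.span k (B ∩ F)

theorem Adapted.mono {B B' : Set M} {F : Submodule k M} (h : Adapted B F) (hB : B ⊆ B') :
    Adapted B' F :=
  h.trans (Submodule.span_mono (Set.inter_subset_inter_left _ hB))

theorem IsBasisOf.subset {B : Set M} {W : Submodule k M} (h : IsBasisOf B W) : B ⊆ W := by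
  rw [← h.2]; exact Submodule.subset_span

theorem IsBasisOf.adapted {B : Set M} {W : Submodule k M} (h : IsBasisOf B W) : Adapted B W := by
  rw [Adapted, Set.inter_eq_left.2 h.subset, h.2]

theorem IsBasisOf.inter {B : Set M} {W F : Submodule k M} (h : IsBasisOf B W)
    (hF : Adapted B F) : IsBasisOf (B ∩ F) F :=
  ⟨h.1.mono Set.inter_subset_left, le_antisymm
    (Submodule.span_le.2 Set.inter_subset_right) hF⟩

theorem isBasisOf_empty : IsBasisOf (k := k) (∅ : Set M) ⊥ :=
  ⟨linearIndepOn_empty _ _, Submodule.span_empty⟩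

theorem adapted_bot (B : Set M) : Adapted B (⊥ : Submodule k M) := bot_le

theorem exists_greatest_of_isChain {α : Type*} [PartialOrder α] {s : Finset α}
    (hs : s.Nonempty) (hc : IsChain (· ≤ ·) (s : Set α)) : ∃ m ∈ s, ∀ x ∈ s, x ≤ m := by
  obtain ⟨m, hm⟩ := s.exists_maximal hs
  refine ⟨m, hm.1, fun x hx => ?_⟩
  rcases hc.total hx hm.1 with h | h
  · exact h
  · exact hm.2 hx h

theorem exists_least_of_isChain {α : Type*} [PartialOrder α] {s : Finset α}
    (hs : s.Nonempty) (hc : IsChain (· ≤ ·) (s : Set α)) : ∃ m ∈ s, ∀ x ∈ s, m ≤ x := by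
  obtain ⟨m, hm⟩ := s.exists_minimal hs
  refine ⟨m, hm.1, fun x hx => ?_⟩
  rcases hc.total hx hm.1 with h | h
  · exact hm.2 hx h
  · exact h

/-- A basis of `X` which is adapted to a chain extends to a basis of `W` adapted to this chain. -/
theorem IsBasisOf.exists_extend_chain {X W : Submodule k M} (hXW : X ≤ W) {B : Set M}
    (hB : IsBasisOf B X) (D : Finset (Submodule k M))
    (hD : IsChain (· ≤ ·) (D : Set (Submodule k M))) (hDW : ∀ F ∈ D, F ≤ W)
    (hBD : ∀ F ∈ D, Adapted B (F ⊓ X)) :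
    ∃ B', B ⊆ B' ∧ IsBasisOf B' W ∧ ∀ F ∈ D, Adapted B' F := by
  classical
  induction hn : D.card generalizing X W B D with
  | zero =>
    obtain rfl := Finset.card_eq_zero.1 hn
    have hBW : B ⊆ (W : Set M) := hB.subset.trans hXW
    exact ⟨hB.1.extend hBW, hB.1.subset_extend hBW,
      ⟨hB.1.linearIndepOn_extend hBW, by rw [hB.1.span_extend_eq_span hBW, Submodule.span_eq]⟩,
      by simp⟩
  | succ n ih =>
    obtain ⟨E, hE, hEmax⟩ := exists_greatest_of_isChain
      (Finset.card_pos.1 (by omega)) hD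
    have hBE : IsBasisOf (B ∩ E) (X ⊓ E) := by
      have := hB.inter (inf_comm E X ▸ hBD E hE)
      convert this using 1
      ext x
      exact ⟨fun h => ⟨h.1, hB.subset h.1, h.2⟩, fun h => ⟨h.1, h.2.2⟩⟩
    obtain ⟨B₁, hBB₁, hB₁, hB₁D⟩ := ih (X := X ⊓ E) (W := E) inf_le_right hBE (D.erase E)
      (hD.mono (by simp)) (fun F hF => hEmax F (Finset.mem_of_mem_erase hF))
      (fun F hF => by
        have hF' := Finset.mem_of_mem_erase hF
        rw [← inf_assoc, inf_eq_left.2 (inf_le_left.trans (hEmax F hF'))]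
        refine (hBD F hF').trans (Submodule.span_mono ?_)
        exact fun x hx => ⟨⟨hx.1, hEmax F hF' hx.2.1⟩, hx.2⟩)
      (by rw [Finset.card_erase_of_mem hE, hn]; rfl)
    have hdis : Disjoint (Submodule.span k B₁) (Submodule.span k (B \ E)) := by
      rw [hB₁.2, Submodule.disjoint_def]
      intro x hxE hx
      have hx1 : x ∈ Submodule.span k (B ∩ E) := by
        rw [hBE.2]
        exact ⟨hB.2 ▸ Submodule.span_mono Set.sdiff_subset hx, hxE⟩
      have := (linearIndepOn_id_union_iff (R := k) (s := B ∩ E) (t := B \ E)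
        (Set.disjoint_sdiff_right.mono_left Set.inter_subset_right)).1
        (by rw [Set.inter_union_sdiff]; exact hB.1)
      exact (Submodule.disjoint_def.1 this.2.2) x hx1 hx
    have hli : LinearIndepOn k id (B₁ ∪ B \ E) :=
      hB₁.1.id_union (hB.1.mono Set.sdiff_subset) hdis
    have hBW : B₁ ∪ B \ E ⊆ (W : Set M) := by
      rintro x (hx | hx)
      · exact hDW E hE (hB₁.subset hx)
      · exact hXW (hB.subset hx.1)
    have hsub := hli.subset_extend hBW
    refine ⟨hli.extend hBW, fun x hx => hsub ?_,
      ⟨hli.linearIndepOn_extend hBW, by rw [hli.span_extend_eq_span hBW, Submodule.span_eq]⟩,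
      fun F hF => ?_⟩
    · by_cases hxE : x ∈ (E : Set M)
      · exact Or.inl (hBB₁ ⟨hx, hxE⟩)
      · exact Or.inr ⟨hx, hxE⟩
    · have h1 : B₁ ⊆ hli.extend hBW := Set.subset_union_left.trans hsub
      by_cases hFE : F = E
      · subst hFE; exact hB₁.adapted.mono h1
      · exact (hB₁D F (Finset.mem_erase.2 ⟨hFE, hF⟩)).mono h1

/-- A basis of `X` adapted to a chain `D` extends to a basis of `W` adapted to `D` and to a given
chain of subspaces between `X` and `W`. -/
theorem IsBasisOf.exists_extend_two_chains {X W : Submodule k M} (hXW : X ≤ W) {B : Set M}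
    (hB : IsBasisOf B X) (C D : Finset (Submodule k M))
    (hC : IsChain (· ≤ ·) (C : Set (Submodule k M)))
    (hD : IsChain (· ≤ ·) (D : Set (Submodule k M)))
    (hXC : ∀ F ∈ C, X ≤ F) (hCW : ∀ F ∈ C, F ≤ W) (hDW : ∀ F ∈ D, F ≤ W)
    (hBD : ∀ F ∈ D, Adapted B (F ⊓ X)) :
    ∃ B', B ⊆ B' ∧ IsBasisOf B' W ∧ (∀ F ∈ C, Adapted B' F) ∧ ∀ F ∈ D, Adapted B' F := by
  classical
  induction hn : C.card generalizing W C D with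
  | zero =>
    obtain rfl := Finset.card_eq_zero.1 hn
    obtain ⟨B', h1, h2, h3⟩ := hB.exists_extend_chain hXW D hD hDW hBD
    exact ⟨B', h1, h2, by simp, h3⟩
  | succ n ih =>
    obtain ⟨E, hE, hEmax⟩ := exists_greatest_of_isChain (Finset.card_pos.1 (by omega)) hC
    have hchain : IsChain (· ≤ ·) (D.image (· ⊓ E) : Set (Submodule k M)) := by
      rw [Finset.coe_image]
      exact hD.image_of_map_rel _ _ _ fun a b h => inf_le_inf_right _ h
    obtain ⟨B₁, h1, h2, h3, h4⟩ := ih (W := E) (hXC E hE) (C.erase E) (D.image (· ⊓ E))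
      (hC.mono (by simp)) hchain (fun F hF => hXC F (Finset.mem_of_mem_erase hF))
      (fun F hF => hEmax F (Finset.mem_of_mem_erase hF))
      (by simp)
      (by
        simp only [Finset.forall_mem_image]
        intro F hF
        rw [inf_assoc, inf_eq_right.2 (hXC E hE)]
        exact hBD F hF)
      (by rw [Finset.card_erase_of_mem hE, hn]; rfl)
    obtain ⟨B', h1', h2', h3'⟩ := h2.exists_extend_chain (hCW E hE) D hD hDW
      (fun F hF => h4 _ (Finset.mem_image_of_mem _ hF))
    refine ⟨B', h1.trans h1', h2', fun F hF => ?_, h3'⟩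
    by_cases hFE : F = E
    · subst hFE; exact h2.adapted.mono h1'
    · exact (h3 F (Finset.mem_erase.2 ⟨hFE, hF⟩)).mono h1'

theorem exists_isBasisOf_two_chains (W : Submodule k M) (C D : Finset (Submodule k M))
    (hC : IsChain (· ≤ ·) (C : Set (Submodule k M)))
    (hD : IsChain (· ≤ ·) (D : Set (Submodule k M)))
    (hCW : ∀ F ∈ C, F ≤ W) (hDW : ∀ F ∈ D, F ≤ W) :
    ∃ B, IsBasisOf B W ∧ (∀ F ∈ C, Adapted B F) ∧ ∀ F ∈ D, Adapted B F := by
  obtain ⟨B, -, h⟩ := isBasisOf_empty.exists_extend_two_chains (bot_le : ⊥ ≤ W) C D hC hD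
    (fun _ _ => bot_le) hCW hDW (fun F _ => by rw [inf_bot_eq]; exact adapted_bot _)
  exact ⟨B, h⟩

/-- Bases of the kernel and of the image of a linear map, both adapted to the traces of a chain,
lift to a basis of the source adapted to this chain. -/
theorem exists_isBasisOf_lift (T : M →ₗ[k] M) (W : Submodule k M) (D : Finset (Submodule k M))
    (hD : IsChain (· ≤ ·) (D : Set (Submodule k M))) (hDW : ∀ F ∈ D, F ≤ W)
    {BK BI : Set M} (hK : IsBasisOf BK (W ⊓ LinearMap.ker T)) (hI : IsBasisOf BI (W.map T))
    (hKD : ∀ F ∈ D, Adapted BK (F ⊓ (W ⊓ LinearMap.ker T)))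
    (hID : ∀ F ∈ D, Adapted BI (F.map T)) :
    ∃ B, BK ⊆ B ∧ IsBasisOf B W ∧ (∀ F ∈ D, Adapted B F) ∧
      (∀ b ∈ B, T b ∈ BI ∨ T b = 0) ∧
      ∀ b ∈ B, ∀ b' ∈ B, T b = T b' → T b ≠ 0 → b = b' := by
  classical
  have hlift : ∀ x : M, ∃ y : M, x ∈ BI → y ∈ W ∧ T y = x ∧ ∀ F ∈ D, x ∈ F.map T → y ∈ F := by
    intro x
    by_cases hx : x ∈ BI
    swap
    · exact ⟨0, fun h => absurd h hx⟩
    have hc : IsChain (· ≤ ·) ((insert W D).filter (fun F => x ∈ F.map T) :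
        Set (Submodule k M)) := by
      refine IsChain.mono (Finset.coe_subset.2 (Finset.filter_subset _ _)) ?_
      rw [Finset.coe_insert]
      exact hD.insert fun F hF _ => Or.inr (hDW F hF)
    obtain ⟨E, hE, hEmin⟩ := exists_least_of_isChain
      ⟨W, Finset.mem_filter.2 ⟨Finset.mem_insert_self _ _, hI.subset hx⟩⟩ hc
    obtain ⟨hE1, y, hy, rfl⟩ := Finset.mem_filter.1 hE
    refine ⟨y, fun _ => ⟨?_, rfl, fun F hF hxF => ?_⟩⟩
    · exact hEmin W (Finset.mem_filter.2 ⟨Finset.mem_insert_self _ _, hI.subset hx⟩) hy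
    · exact hEmin F (Finset.mem_filter.2 ⟨Finset.mem_insert_of_mem hF, hxF⟩) hy
  choose l hl using hlift
  have hTl : ∀ x ∈ BI, T (l x) = x := fun x hx => (hl x hx).2.1
  have hcomp : LinearIndepOn k (T ∘ l) BI := hI.1.congr fun x hx => (hTl x hx).symm
  have hlI : LinearIndepOn k id (l '' BI) := (hcomp.of_comp T).id_image
  have hBK0 : ∀ b ∈ BK, T b = 0 := fun b hb => (hK.subset hb).2
  have hdis : Disjoint (Submodule.span k BK) (Submodule.span k (l '' BI)) := by
    have h : Disjoint (Submodule.span k (l '' BI)) (LinearMap.ker T) := by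
      have := Submodule.range_ker_disjoint (v := fun x : BI => l x) (f := T) hcomp
      rwa [← Set.image_eq_range] at this
    exact (h.mono_right (Submodule.span_le.2 fun b hb => hBK0 b hb)).symm
  have key : ∀ F : Submodule k M, F ≤ W → Adapted BK (F ⊓ (W ⊓ LinearMap.ker T)) →
      Adapted BI (F.map T) → (∀ x ∈ BI, x ∈ F.map T → l x ∈ F) → Adapted (BK ∪ l '' BI) F := by
    intro F hFW h1 h2 h3 x hx
    have hx' : T x ∈ Submodule.span k (T '' (l '' (BI ∩ F.map T))) := by
      refine Submodule.span_mono ?_ (h2 ⟨x, hx, rfl⟩)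
      exact fun y hy => ⟨l y, ⟨y, hy, rfl⟩, hTl y hy.1⟩
    rw [Submodule.span_image] at hx'
    obtain ⟨z, hz, hzx⟩ := hx'
    have hzF : z ∈ F := by
      refine Submodule.span_le.2 ?_ hz
      rintro _ ⟨y, hy, rfl⟩
      exact h3 y hy.1 hy.2
    have hz' : z ∈ Submodule.span k ((BK ∪ l '' BI) ∩ F) := by
      refine Submodule.span_mono ?_ hz
      rintro _ ⟨y, hy, rfl⟩
      exact ⟨Or.inr ⟨y, hy.1, rfl⟩, h3 y hy.1 hy.2⟩
    have hxz : x - z ∈ Submodule.span k ((BK ∪ l '' BI) ∩ F) := by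
      have := h1 (x := x - z) ⟨sub_mem hx hzF, hFW (sub_mem hx hzF), by simp [hzx]⟩
      refine Submodule.span_mono ?_ this
      exact fun y hy => ⟨Or.inl hy.1, hy.2.1⟩
    simpa using add_mem hxz hz'
  have hBW : BK ∪ l '' BI ⊆ (W : Set M) := by
    rintro x (hx | ⟨y, hy, rfl⟩)
    · exact (hK.subset hx).1
    · exact (hl y hy).1
  refine ⟨BK ∪ l '' BI, Set.subset_union_left, ⟨hK.1.id_union hlI hdis, ?_⟩, fun F hF =>
    key F (hDW F hF) (hKD F hF) (hID F hF) (fun x hx => (hl x hx).2.2 F hF), ?_, ?_⟩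
  · refine le_antisymm (Submodule.span_le.2 hBW) ?_
    have := key W le_rfl (by rw [← inf_assoc, inf_idem]; exact hK.adapted) hI.adapted
      (fun x hx _ => (hl x hx).1)
    exact this.trans (Submodule.span_mono Set.inter_subset_left)
  · rintro b (hb | ⟨y, hy, rfl⟩)
    · exact Or.inr (hBK0 b hb)
    · exact Or.inl (by rwa [hTl y hy])
  · rintro b (hb | ⟨y, hy, rfl⟩) b' (hb' | ⟨y', hy', rfl⟩) h h0
    · exact absurd (hBK0 b hb) h0
    · exact absurd (hBK0 b hb) h0
    · exact absurd (h.trans (hBK0 b' hb')) h0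
    · rw [hTl y hy, hTl y' hy'] at h; rw [h]

/-- The nonzero images of a basis adapted to the kernel of a linear map form a basis of the
image. -/
theorem IsBasisOf.map_diff_zero {T : M →ₗ[k] M} {W : Submodule k M} {B : Set M}
    (hB : IsBasisOf B W) (hker : Adapted B (W ⊓ LinearMap.ker T)) :
    IsBasisOf (T '' B \ {0}) (W.map T) ∧
      (∀ b ∈ B, ∀ b' ∈ B, T b = T b' → T b ≠ 0 → b = b') ∧
      ∀ F : Submodule k M, Adapted B (F.comap T ⊓ W) → Adapted (T '' B \ {0}) (F ⊓ W.map T) := by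
  have hspan : ∀ s : Set M, Submodule.span k (T '' s \ {0}) = (Submodule.span k s).map T := by
    intro s
    rw [← Submodule.span_image, Submodule.span_sdiff_singleton_zero]
  have himg : T '' B \ {0} = T '' (B \ LinearMap.ker T) := by
    ext x
    constructor
    · rintro ⟨⟨b, hb, rfl⟩, h0⟩; exact ⟨b, ⟨hb, h0⟩, rfl⟩
    · rintro ⟨b, ⟨hb, h0⟩, rfl⟩; exact ⟨⟨b, hb, rfl⟩, h0⟩
  have hBW := hB.subset
  have hdis : Disjoint (Submodule.span k (B \ LinearMap.ker T)) (LinearMap.ker T) := by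
    rw [Submodule.disjoint_def]
    intro x hx hxT
    have hxW : x ∈ W := hB.2 ▸ Submodule.span_mono Set.sdiff_subset hx
    have := (linearIndepOn_id_union_iff (R := k) (s := B ∩ LinearMap.ker T)
      (t := B \ LinearMap.ker T)
      (Set.disjoint_sdiff_right.mono_left Set.inter_subset_right)).1
      (by rw [Set.inter_union_sdiff]; exact hB.1)
    refine (Submodule.disjoint_def.1 this.2.2) x (Submodule.span_mono ?_ (hker ⟨hxW, hxT⟩)) hx
    exact fun y hy => ⟨hy.1, hy.2.2⟩
  have hli : LinearIndepOn k id (B \ LinearMap.ker T) := hB.1.mono Set.sdiff_subset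
  refine ⟨⟨?_, by rw [hspan, hB.2]⟩, ?_, ?_⟩
  · rw [himg]
    exact hli.image hdis
  · intro b hb b' hb' h h0
    have h1 : b - b' ∈ Submodule.span k (B \ LinearMap.ker T) :=
      sub_mem (Submodule.subset_span ⟨hb, h0⟩)
        (Submodule.subset_span ⟨hb', fun h' => h0 (h.trans h')⟩)
    have := (Submodule.disjoint_def.1 hdis) _ h1 (by simp [h])
    exact sub_eq_zero.1 this
  · rintro F hF _ ⟨hxF, x, hx, rfl⟩
    have := Submodule.mem_map_of_mem (f := T) (hF ⟨hxF, hx⟩)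
    rw [← hspan] at this
    refine Submodule.span_mono ?_ this
    rintro _ ⟨⟨b, hb, rfl⟩, h0⟩
    exact ⟨⟨⟨b, hb.1, rfl⟩, h0⟩, hb.2.1, b, hb.2.2, rfl⟩

end AdaptedBases

section SidedRepresentations

variable {k M : Type*} [Field k] [AddCommGroup M] [Module k M] {Q : QuiverData}

/-- A representation of a quiver inside an ambient space, where each vertex has two sides, each
arrow starts and ends at a given side, each side has at most one incoming and at most one outgoing
arrow, and the composite of two arrows meeting at the same side vanishes. -/
structure SidedRep (k M : Type*) [Field k] [AddCommGroup M] [Module k M] (Q : QuiverData) where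
  space : Fin Q.nV → Submodule k M
  map : Fin Q.nE → M →ₗ[k] M
  outSide : Fin Q.nE → Bool
  inSide : Fin Q.nE → Bool
  map_le : ∀ a, (space (Q.src a)).map (map a) ≤ space (Q.tgt a)
  comp_eq_zero : ∀ a b, Q.tgt a = Q.src b → inSide a = outSide b → ∀ x, map b (map a x) = 0
  outSide_inj : ∀ a b, Q.src a = Q.src b → outSide a = outSide b → a = b
  inSide_inj : ∀ a b, Q.tgt a = Q.tgt b → inSide a = inSide b → a = b

namespace SidedRep

variable (R : SidedRep k M Q)

/-- Bases of the spaces at the vertices of `S` such that each arrow between vertices of `S`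
induces a partial injection between basis elements. -/
structure StringBasis (S : Finset (Fin Q.nV)) (B : Fin Q.nV → Set M) : Prop where
  basis : ∀ v ∈ S, IsBasisOf (B v) (R.space v)
  map : ∀ a, Q.src a ∈ S → Q.tgt a ∈ S → ∀ b ∈ B (Q.src a),
    R.map a b ∈ B (Q.tgt a) ∨ R.map a b = 0
  inj : ∀ a, Q.src a ∈ S → Q.tgt a ∈ S → ∀ b ∈ B (Q.src a), ∀ b' ∈ B (Q.src a),
    R.map a b = R.map a b' → R.map a b ≠ 0 → b = b'

/-- For each side at each vertex, a chain of subspaces which lie between the image of the incoming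
arrow at this side and the kernel of the outgoing arrow at this side. -/
structure ChainSystem (S : Finset (Fin Q.nV))
    (C : Fin Q.nV → Bool → Finset (Submodule k M)) : Prop where
  chain : ∀ v ∈ S, ∀ s, IsChain (· ≤ ·) (C v s : Set (Submodule k M))
  le_space : ∀ v ∈ S, ∀ s, ∀ F ∈ C v s, F ≤ R.space v
  le_ker : ∀ a, Q.src a ∈ S → Q.tgt a ∈ S → ∀ F ∈ C (Q.src a) (R.outSide a),
    F ≤ LinearMap.ker (R.map a)
  im_le : ∀ a, Q.src a ∈ S → Q.tgt a ∈ S → ∀ F ∈ C (Q.tgt a) (R.inSide a),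
    (R.space (Q.src a)).map (R.map a) ≤ F

/-- Any chain system on `S` admits an adapted string basis. -/
def HasStringBases (S : Finset (Fin Q.nV)) : Prop :=
  ∀ C, R.ChainSystem S C → ∃ B, R.StringBasis S B ∧ ∀ v ∈ S, ∀ s, ∀ F ∈ C v s, Adapted (B v) F

variable {R}

theorem ChainSystem.mono {S S' : Finset (Fin Q.nV)} (h : S' ⊆ S)
    {C : Fin Q.nV → Bool → Finset (Submodule k M)} (hC : R.ChainSystem S C) :
    R.ChainSystem S' C where
  chain v hv := hC.chain v (h hv)
  le_space v hv := hC.le_space v (h hv)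
  le_ker a ha ha' := hC.le_ker a (h ha) (h ha')
  im_le a ha ha' := hC.im_le a (h ha) (h ha')

theorem StringBasis.update {S : Finset (Fin Q.nV)} {B : Fin Q.nV → Set M}
    (hB : R.StringBasis S B) {v : Fin Q.nV} (hv : v ∉ S) {Bv : Set M}
    (hBv : IsBasisOf Bv (R.space v)) (hloop : ∀ a, Q.src a = v → Q.tgt a ≠ v)
    (hout : ∀ a, Q.src a = v → Q.tgt a ∈ S → (∀ b ∈ Bv, R.map a b ∈ B (Q.tgt a) ∨ R.map a b = 0) ∧
      ∀ b ∈ Bv, ∀ b' ∈ Bv, R.map a b = R.map a b' → R.map a b ≠ 0 → b = b')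
    (hin : ∀ a, Q.tgt a = v → Q.src a ∈ S → (∀ b ∈ B (Q.src a), R.map a b ∈ Bv ∨ R.map a b = 0) ∧
      ∀ b ∈ B (Q.src a), ∀ b' ∈ B (Q.src a), R.map a b = R.map a b' → R.map a b ≠ 0 → b = b') :
    R.StringBasis (insert v S) (Function.update B v Bv) := by
  have hne : ∀ w ∈ S, Function.update B v Bv w = B w := fun w hw =>
    Function.update_of_ne (fun h : w = v => hv (h ▸ hw)) _ _
  have hmain : ∀ a, Q.src a ∈ insert v S → Q.tgt a ∈ insert v S →
      (∀ b ∈ Function.update B v Bv (Q.src a),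
        R.map a b ∈ Function.update B v Bv (Q.tgt a) ∨ R.map a b = 0) ∧
      ∀ b ∈ Function.update B v Bv (Q.src a), ∀ b' ∈ Function.update B v Bv (Q.src a),
        R.map a b = R.map a b' → R.map a b ≠ 0 → b = b' := by
    intro a hs ht
    rcases Finset.mem_insert.1 hs with hs | hs <;> rcases Finset.mem_insert.1 ht with ht | ht
    · exact absurd ht (hloop a hs)
    · rw [hne _ ht, hs, Function.update_self]; exact hout a hs ht
    · rw [hne _ hs, ht, Function.update_self]; exact hin a ht hs
    · rw [hne _ hs, hne _ ht]; exact ⟨hB.map a hs ht, hB.inj a hs ht⟩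
  refine ⟨fun w hw => ?_, fun a hs ht => (hmain a hs ht).1, fun a hs ht => (hmain a hs ht).2⟩
  rcases Finset.mem_insert.1 hw with rfl | hw
  · rwa [Function.update_self]
  · rw [hne _ hw]; exact hB.basis w hw

theorem adapted_update {S : Finset (Fin Q.nV)} {B : Fin Q.nV → Set M} {v : Fin Q.nV} (hv : v ∉ S)
    {Bv : Set M} {C : Fin Q.nV → Bool → Finset (Submodule k M)}
    (hB : ∀ w ∈ S, ∀ s, ∀ F ∈ C w s, Adapted (B w) F) (hBv : ∀ s, ∀ F ∈ C v s, Adapted Bv F) :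
    ∀ w ∈ insert v S, ∀ s, ∀ F ∈ C w s, Adapted (Function.update B v Bv w) F := by
  intro w hw
  rcases Finset.mem_insert.1 hw with rfl | hw
  · rwa [Function.update_self]
  · rw [Function.update_of_ne (fun h : w = v => hv (h ▸ hw))]; exact hB w hw

/-- Enlarging the chain at one side of a chain system. -/
theorem ChainSystem.update {S : Finset (Fin Q.nV)}
    {C : Fin Q.nV → Bool → Finset (Submodule k M)} (hC : R.ChainSystem S C)
    {w : Fin Q.nV} (hw : w ∈ S) (s : Bool) (D : Finset (Submodule k M))
    (hchain : IsChain (· ≤ ·) (C w s ∪ D : Set (Submodule k M)))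
    (hspace : ∀ F ∈ D, F ≤ R.space w)
    (hker : ∀ a, Q.src a = w → Q.tgt a ∈ S → R.outSide a = s → ∀ F ∈ D,
      F ≤ LinearMap.ker (R.map a))
    (him : ∀ a, Q.tgt a = w → Q.src a ∈ S → R.inSide a = s → ∀ F ∈ D,
      (R.space (Q.src a)).map (R.map a) ≤ F) :
    ∃ C', R.ChainSystem S C' ∧ (∀ u t, C u t ⊆ C' u t) ∧ D ⊆ C' w s := by
  classical
  refine ⟨fun u t => if u = w ∧ t = s then C u t ∪ D else C u t, ⟨?_, ?_, ?_, ?_⟩, ?_, ?_⟩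
  · intro v hv t
    split_ifs with h
    · obtain ⟨rfl, rfl⟩ := h
      rwa [Finset.coe_union]
    · exact hC.chain v hv t
  · intro v hv t F hF
    split_ifs at hF with h
    · obtain ⟨rfl, rfl⟩ := h
      rcases Finset.mem_union.1 hF with hF | hF
      · exact hC.le_space _ hv _ F hF
      · exact hspace F hF
    · exact hC.le_space v hv t F hF
  · intro a ha ha' F hF
    split_ifs at hF with h
    · rcases Finset.mem_union.1 hF with hF | hF
      · exact hC.le_ker a ha ha' F hF
      · exact hker a h.1 ha' h.2 F hF
    · exact hC.le_ker a ha ha' F hF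
  · intro a ha ha' F hF
    split_ifs at hF with h
    · rcases Finset.mem_union.1 hF with hF | hF
      · exact hC.im_le a ha ha' F hF
      · exact him a h.1 ha h.2 F hF
    · exact hC.im_le a ha ha' F hF
  · intro u t
    dsimp only
    split_ifs
    · exact Finset.subset_union_left
    · exact subset_rfl
  · simp

theorem IsChain.union_of_le {α : Type*} [Preorder α] {s t : Set α} (hs : IsChain (· ≤ ·) s)
    (ht : IsChain (· ≤ ·) t) (h : ∀ x ∈ s, ∀ y ∈ t, x ≤ y) : IsChain (· ≤ ·) (s ∪ t) := by
  rintro x (hx | hx) y (hy | hy) hxy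
  · exact hs hx hy hxy
  · exact Or.inl (h x hx y hy)
  · exact Or.inr (h y hy x hx)
  · exact ht hx hy hxy

theorem bool_cases (p : Bool → Prop) (s : Bool) (h : p s) (h' : p !s) : ∀ t, p t := by
  intro t
  cases s <;> cases t <;> assumption

/-- Existence of adapted string bases propagates to a new vertex attached by at most one arrow. -/
theorem HasStringBases.insert_vertex {S : Finset (Fin Q.nV)} (hS : R.HasStringBases S)
    {v : Fin Q.nV}
    (hv : v ∉ S) (hloop : ∀ a, Q.src a = v → Q.tgt a ≠ v)
    (hleaf : ∀ a b, (Q.src a = v ∧ Q.tgt a ∈ S ∨ Q.tgt a = v ∧ Q.src a ∈ S) →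
      (Q.src b = v ∧ Q.tgt b ∈ S ∨ Q.tgt b = v ∧ Q.src b ∈ S) → a = b) :
    R.HasStringBases (insert v S) := by
  classical
  intro C hC
  have hvS : v ∈ insert v S := Finset.mem_insert_self _ _
  have hSS : S ⊆ insert v S := Finset.subset_insert _ _
  have hCS := hC.mono hSS
  by_cases hex : ∃ a, Q.src a = v ∧ Q.tgt a ∈ S ∨ Q.tgt a = v ∧ Q.src a ∈ S
  swap
  · obtain ⟨B, hB, hBC⟩ := hS C hCS
    obtain ⟨Bv, hBv, h1, h2⟩ := exists_isBasisOf_two_chains (R.space v) (C v true) (C v false)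
      (hC.chain v hvS _) (hC.chain v hvS _) (hC.le_space v hvS _) (hC.le_space v hvS _)
    refine ⟨_, hB.update hv hBv hloop (fun a h h' => absurd ⟨a, Or.inl ⟨h, h'⟩⟩ hex)
      (fun a h h' => absurd ⟨a, Or.inr ⟨h, h'⟩⟩ hex), adapted_update hv hBC
      (bool_cases _ true h1 h2)⟩
  obtain ⟨a, ⟨rfl, ha⟩ | ⟨rfl, ha⟩⟩ := hex
  · have huniq : ∀ b, (Q.src b = Q.src a ∧ Q.tgt b ∈ S ∨ Q.tgt b = Q.src a ∧ Q.src b ∈ S) →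
        b = a := fun b hb => hleaf b a hb (Or.inl ⟨rfl, ha⟩)
    let G := C (Q.src a) (!R.outSide a)
    have hGch : IsChain (· ≤ ·) (G : Set (Submodule k M)) := hC.chain _ hvS _
    have hGW : ∀ F ∈ G, F ≤ R.space (Q.src a) := hC.le_space _ hvS _
    obtain ⟨C', hC', hCC', hDC'⟩ := hCS.update ha (R.inSide a)
      ((insert (R.space (Q.src a)) G).image (Submodule.map (R.map a)))
      (by
        rw [Set.union_comm]
        refine IsChain.union_of_le ?_ (hC.chain _ (hSS ha) _) ?_
        · rw [Finset.coe_image, Finset.coe_insert]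
          exact (hGch.insert fun F hF _ => Or.inr (hGW F hF)).image_of_map_rel _ _ _
            fun _ _ h => Submodule.map_mono h
        · intro x hx y hy
          obtain ⟨F, hF, rfl⟩ := Finset.mem_image.1 hx
          refine (Submodule.map_mono ?_).trans (hC.im_le a hvS (hSS ha) y hy)
          rcases Finset.mem_insert.1 hF with rfl | hF
          exacts [le_rfl, hGW F hF])
      (by
        simp only [Finset.forall_mem_image]
        intro F hF
        refine (Submodule.map_mono ?_).trans (R.map_le a)
        rcases Finset.mem_insert.1 hF with rfl | hF
        exacts [le_rfl, hGW F hF])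
      (by
        simp only [Finset.forall_mem_image]
        rintro b hb - hside F - _ ⟨x, -, rfl⟩
        exact R.comp_eq_zero a b hb.symm hside.symm x)
      (by
        intro b hb hb' hside
        obtain rfl := R.inSide_inj b a hb hside
        exact absurd hb' hv)
    obtain ⟨B, hB, hBC⟩ := hS C' hC'
    have hBD : ∀ F ∈ insert (R.space (Q.src a)) G, Adapted (B (Q.tgt a)) (F.map (R.map a)) :=
      fun F hF => hBC _ ha _ _ (hDC' (Finset.mem_image_of_mem _ hF))
    obtain ⟨BK, hBK, hK1, hK2⟩ := exists_isBasisOf_two_chains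
      (R.space (Q.src a) ⊓ LinearMap.ker (R.map a)) (C (Q.src a) (R.outSide a))
      (G.image (· ⊓ (R.space (Q.src a) ⊓ LinearMap.ker (R.map a)))) (hC.chain _ hvS _)
      (by
        rw [Finset.coe_image]
        exact hGch.image_of_map_rel _ _ _ fun _ _ h => inf_le_inf_right _ h)
      (fun F hF => le_inf (hC.le_space _ hvS _ F hF) (hC.le_ker a hvS (hSS ha) F hF))
      (by simp only [Finset.forall_mem_image]; exact fun F _ => inf_le_right)
    have hI := (hB.basis _ ha).inter (hBD _ (Finset.mem_insert_self _ _))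
    obtain ⟨Bv, hKv, hBv, hBvG, hBvm, hBvi⟩ := exists_isBasisOf_lift (R.map a)
      (R.space (Q.src a)) G hGch hGW hBK hI
      (fun F hF => hK2 _ (Finset.mem_image_of_mem _ hF))
      (fun F hF => (hBD F (Finset.mem_insert_of_mem hF)).trans (Submodule.span_mono
        fun x hx => ⟨⟨hx.1, Submodule.map_mono (hGW F hF) hx.2⟩, hx.2⟩))
    refine ⟨_, hB.update hv hBv hloop ?_ ?_, adapted_update hv
      (fun w hw s F hF => hBC w hw s F (hCC' w s hF))
      (bool_cases _ (R.outSide a) (fun F hF => (hK1 F hF).mono hKv) hBvG)⟩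
    · intro b hb hb'
      obtain rfl := huniq b (Or.inl ⟨hb, hb'⟩)
      exact ⟨fun x hx => (hBvm x hx).imp (fun h => h.1) id, hBvi⟩
    · intro b hb hb'
      obtain rfl := huniq b (Or.inr ⟨hb, hb'⟩)
      exact absurd hb' hv
  · have huniq : ∀ b, (Q.src b = Q.tgt a ∧ Q.tgt b ∈ S ∨ Q.tgt b = Q.tgt a ∧ Q.src b ∈ S) →
        b = a := fun b hb => hleaf b a hb (Or.inr ⟨rfl, ha⟩)
    let G := C (Q.tgt a) (!R.inSide a)
    have hGch : IsChain (· ≤ ·) (G : Set (Submodule k M)) := hC.chain _ hvS _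
    have hGW : ∀ F ∈ G, F ≤ R.space (Q.tgt a) := hC.le_space _ hvS _
    have hker : ∀ F : Submodule k M, R.space (Q.src a) ⊓ LinearMap.ker (R.map a) ≤
        F.comap (R.map a) ⊓ R.space (Q.src a) := by
      rintro F x ⟨hx, hx'⟩
      refine ⟨?_, hx⟩
      rw [SetLike.mem_coe, Submodule.mem_comap, LinearMap.mem_ker.1 hx']
      exact zero_mem _
    obtain ⟨C', hC', hCC', hDC'⟩ := hCS.update ha (R.outSide a)
      ((insert ⊥ G).image fun F => F.comap (R.map a) ⊓ R.space (Q.src a))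
      (by
        refine IsChain.union_of_le (hC.chain _ (hSS ha) _) ?_ ?_
        · rw [Finset.coe_image, Finset.coe_insert]
          exact (hGch.insert fun F _ _ => Or.inl bot_le).image_of_map_rel _ _ _
            fun _ _ h => inf_le_inf_right _ (Submodule.comap_mono h)
        · intro x hx y hy
          obtain ⟨F, hF, rfl⟩ := Finset.mem_image.1 hy
          exact (le_inf (hC.le_space _ (hSS ha) _ x hx)
            (hC.le_ker a (hSS ha) hvS x hx)).trans (hker F))
      (by simp)
      (by
        intro b hb hb' hside
        obtain rfl := R.outSide_inj b a hb hside
        exact absurd hb' hv)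
      (by
        simp only [Finset.forall_mem_image]
        rintro b hb - hside F - _ ⟨x, hx, rfl⟩
        refine hker F ⟨?_, R.comp_eq_zero b a hb hside x⟩
        exact hb ▸ R.map_le b ⟨x, hx, rfl⟩)
    obtain ⟨B, hB, hBC⟩ := hS C' hC'
    have hBD : ∀ F ∈ insert ⊥ G, Adapted (B (Q.src a)) (F.comap (R.map a) ⊓ R.space (Q.src a)) :=
      fun F hF => hBC _ ha _ _ (hDC' (Finset.mem_image_of_mem _ hF))
    obtain ⟨hX, hXi, hXG⟩ := (hB.basis _ ha).map_diff_zero (T := R.map a) (by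
      rw [inf_comm, LinearMap.ker]
      exact hBD ⊥ (Finset.mem_insert_self _ _))
    obtain ⟨Bv, hXv, hBv, hBvF, hBvG⟩ := hX.exists_extend_two_chains (R.map_le a)
      (C (Q.tgt a) (R.inSide a)) G (hC.chain _ hvS _) hGch (hC.im_le a (hSS ha) hvS)
      (hC.le_space _ hvS _) hGW (fun F hF => hXG F (hBD F (Finset.mem_insert_of_mem hF)))
    refine ⟨_, hB.update hv hBv hloop ?_ ?_, adapted_update hv
      (fun w hw s F hF => hBC w hw s F (hCC' w s hF))
      (bool_cases _ (R.inSide a) hBvF hBvG)⟩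
    · intro b hb hb'
      obtain rfl := huniq b (Or.inl ⟨hb, hb'⟩)
      exact absurd hb' hv
    · intro b hb hb'
      obtain rfl := huniq b (Or.inr ⟨hb, hb'⟩)
      refine ⟨fun x hx => ?_, hXi⟩
      by_cases h0 : R.map b x = 0
      · exact Or.inr h0
      · exact Or.inl (hXv ⟨⟨x, hx, rfl⟩, h0⟩)

/-- Adapted string bases exist on a set of vertices whose arrows form full-relational cycles. -/
theorem hasStringBases_of_cycle {S : Finset (Fin Q.nV)} {Z : Set (Fin Q.nE)}
    (hZ : ∀ a, Q.src a ∈ S → Q.tgt a ∈ S → a ∈ Z)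
    (hin : ∀ v ∈ S, ∃ a ∈ Z, Q.src a ∈ S ∧ Q.tgt a = v)
    (hout : ∀ v ∈ S, ∃ a ∈ Z, Q.src a = v ∧ Q.tgt a ∈ S)
    (hrel : ∀ a ∈ Z, ∀ b ∈ Z, Q.tgt a = Q.src b → R.inSide a = R.outSide b)
    (hsrc : ∀ a ∈ Z, ∀ b ∈ Z, Q.src a = Q.src b → a = b)
    (htgt : ∀ a ∈ Z, ∀ b ∈ Z, Q.tgt a = Q.tgt b → a = b) :
    R.HasStringBases S := by
  classical
  intro C hC
  have him : ∀ a, ∃ BI : Set M, Q.src a ∈ S → Q.tgt a ∈ S →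
      IsBasisOf BI ((R.space (Q.src a)).map (R.map a)) ∧
      (∀ F ∈ C (Q.tgt a) (!R.inSide a),
        Adapted BI (F ⊓ (R.space (Q.src a)).map (R.map a))) ∧
      ∀ F ∈ C (Q.src a) (!R.outSide a), Adapted BI (F.map (R.map a)) := by
    intro a
    by_cases hs : Q.src a ∈ S
    swap
    · exact ⟨∅, fun h => absurd h hs⟩
    by_cases ht : Q.tgt a ∈ S
    swap
    · exact ⟨∅, fun _ h => absurd h ht⟩
    obtain ⟨BI, h1, h2, h3⟩ := exists_isBasisOf_two_chains ((R.space (Q.src a)).map (R.map a))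
      ((C (Q.tgt a) (!R.inSide a)).image (· ⊓ (R.space (Q.src a)).map (R.map a)))
      ((C (Q.src a) (!R.outSide a)).image (Submodule.map (R.map a)))
      (by
        rw [Finset.coe_image]
        exact (hC.chain _ ht _).image_of_map_rel _ _ _ fun _ _ h => inf_le_inf_right _ h)
      (by
        rw [Finset.coe_image]
        exact (hC.chain _ hs _).image_of_map_rel _ _ _ fun _ _ h => Submodule.map_mono h)
      (by simp)
      (by
        simp only [Finset.forall_mem_image]
        exact fun F hF => Submodule.map_mono (hC.le_space _ hs _ F hF))
    exact ⟨BI, fun _ _ => ⟨h1, fun F hF => h2 _ (Finset.mem_image_of_mem _ hF),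
      fun F hF => h3 _ (Finset.mem_image_of_mem _ hF)⟩⟩
  choose BI hBI using him
  have hvert : ∀ v, ∃ Bv : Set M, v ∈ S → IsBasisOf Bv (R.space v) ∧
      (∀ s, ∀ F ∈ C v s, Adapted Bv F) ∧
      (∀ a, Q.src a ∈ S → Q.tgt a = v → BI a ⊆ Bv) ∧
      ∀ a, Q.src a = v → Q.tgt a ∈ S → (∀ b ∈ Bv, R.map a b ∈ BI a ∨ R.map a b = 0) ∧
        ∀ b ∈ Bv, ∀ b' ∈ Bv, R.map a b = R.map a b' → R.map a b ≠ 0 → b = b' := by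
    intro v
    by_cases hv : v ∈ S
    swap
    · exact ⟨∅, fun h => absurd h hv⟩
    obtain ⟨a, haZ, haS, hav⟩ := hin v hv
    obtain ⟨c, hcZ, hcv, hcS⟩ := hout v hv
    have hac : R.inSide a = R.outSide c := hrel a haZ c hcZ (hav.trans hcv.symm)
    obtain ⟨ha1, ha2, -⟩ := hBI a haS (hav ▸ hv)
    obtain ⟨hc1, -, hc3⟩ := hBI c (hcv ▸ hv) hcS
    have hXK : (R.space (Q.src a)).map (R.map a) ≤ R.space v ⊓ LinearMap.ker (R.map c) := by
      refine le_inf (hav ▸ R.map_le a) ?_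
      rintro _ ⟨x, -, rfl⟩
      exact R.comp_eq_zero a c (hav.trans hcv.symm) hac x
    let G := C v (!R.outSide c)
    have hGch : IsChain (· ≤ ·) (G : Set (Submodule k M)) := hC.chain v hv _
    have hGW : ∀ F ∈ G, F ≤ R.space v := hC.le_space v hv _
    obtain ⟨BK, hXBK, hBK, hKC, hKG⟩ := ha1.exists_extend_two_chains hXK (C v (R.outSide c))
      (G.image (· ⊓ (R.space v ⊓ LinearMap.ker (R.map c)))) (hC.chain v hv _)
      (by
        rw [Finset.coe_image]
        exact hGch.image_of_map_rel _ _ _ fun _ _ h => inf_le_inf_right _ h)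
      (by
        rw [← hac, ← hav]
        exact hC.im_le a haS (hav ▸ hv))
      (fun F hF => le_inf (hC.le_space v hv _ F hF)
        (hC.le_ker c (hcv ▸ hv) hcS F (hcv ▸ hF)))
      (by simp only [Finset.forall_mem_image]; exact fun F _ => inf_le_right)
      (by
        simp only [Finset.forall_mem_image]
        intro F hF
        rw [inf_assoc, inf_eq_right.2 hXK]
        refine ha2 F ?_
        rw [hav, hac]
        exact hF)
    rw [hcv] at hc1 hc3
    obtain ⟨Bv, hKv, hBv, hBvG, hBvm, hBvi⟩ := exists_isBasisOf_lift (R.map c) (R.space v) G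
      hGch hGW hBK hc1 (fun F hF => hKG _ (Finset.mem_image_of_mem _ hF)) hc3
    refine ⟨Bv, fun _ => ⟨hBv, bool_cases _ (R.outSide c) (fun F hF => (hKC F hF).mono hKv) hBvG,
      ?_, ?_⟩⟩
    · intro b hb hbv
      obtain rfl := htgt b (hZ b hb (hbv ▸ hv)) a haZ (hbv.trans hav.symm)
      exact hXBK.trans hKv
    · intro b hbv hb
      obtain rfl := hsrc b (hZ b (hbv ▸ hv) hb) c hcZ (hbv.trans hcv.symm)
      exact ⟨hBvm, hBvi⟩
  choose B hB using hvert
  refine ⟨B, ⟨fun v hv => (hB v hv).1, fun a hs ht b hb => ?_, fun a hs ht =>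
    ((hB _ hs).2.2.2 a rfl ht).2⟩, fun v hv => (hB v hv).2.1⟩
  exact (((hB _ hs).2.2.2 a rfl ht).1 b hb).imp (fun h => (hB _ ht).2.2.1 a hs rfl h) id

end SidedRep

end SidedRepresentations

section UnderlyingGraph

namespace QuiverData

variable {Q : QuiverData}

/-- The arrow `e` has endpoints `u` and `w`. -/
def Joins (Q : QuiverData) (e : Fin Q.nE) (u w : Fin Q.nV) : Prop :=
  Q.src e = u ∧ Q.tgt e = w ∨ Q.tgt e = u ∧ Q.src e = w

theorem Joins.symm {e : Fin Q.nE} {u w : Fin Q.nV} (h : Q.Joins e u w) : Q.Joins e w u :=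
  h.elim (fun h => Or.inr ⟨h.2, h.1⟩) fun h => Or.inl ⟨h.2, h.1⟩

theorem joins_src_tgt (e : Fin Q.nE) : Q.Joins e (Q.src e) (Q.tgt e) := Or.inl ⟨rfl, rfl⟩

theorem Joins.endpoints {e : Fin Q.nE} {u w u' w' : Fin Q.nV} (h : Q.Joins e u w)
    (h' : Q.Joins e u' w') : u = u' ∧ w = w' ∨ u = w' ∧ w = u' := by
  rcases h with ⟨rfl, rfl⟩ | ⟨rfl, rfl⟩ <;> rcases h' with ⟨rfl, rfl⟩ | ⟨rfl, rfl⟩ <;> simp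

theorem exists_uCycle {l : ℕ} (hl : 1 ≤ l) {v : ℕ → Fin Q.nV} {e : ℕ → Fin Q.nE}
    (hj : ∀ i < l, Q.Joins (e i) (v i) (v ((i + 1) % l)))
    (hv : ∀ i j, i < l → j < l → v i = v j → i = j)
    (he : ∀ i j, i < l → j < l → e i = e j → i = j) :
    ∃ C : UCycle Q, C.edgeSet = {x | ∃ i < l, e i = x} := by
  classical
  have hmod : ∀ i, i % l < l := fun i => Nat.mod_lt _ hl
  have hj' : ∀ i, Q.Joins (e (i % l)) (v (i % l)) (v ((i + 1) % l)) := by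
    intro i
    simpa [Nat.mod_add_mod] using hj _ (hmod i)
  refine ⟨⟨l, hl, fun i => e (i % l),
    fun i => decide (Q.src (e (i % l)) = v (i % l) ∧ Q.tgt (e (i % l)) = v ((i + 1) % l)),
    fun i => v (i % l), fun i => by simp, fun i => by
      simp only [Nat.add_right_comm i l 1, Nat.add_mod_right], fun i => by simp,
    fun i hi => of_decide_eq_true hi, fun i hi => (hj' i).resolve_left (of_decide_eq_false hi),
    fun i j hi hj h => ?_, fun i j hi hj h => ?_⟩, ?_⟩
  · simp only [Nat.mod_eq_of_lt hi, Nat.mod_eq_of_lt hj] at h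
    exact hv i j hi hj h
  · simp only [Nat.mod_eq_of_lt hi, Nat.mod_eq_of_lt hj] at h
    exact he i j hi hj h
  · ext x
    simp only [UCycle.edgeSet, Set.mem_ofPred_eq]
    refine exists_congr fun i => and_congr_right fun hi => ?_
    rw [Nat.mod_eq_of_lt hi]

/-- A walk without backtracking that visits a vertex twice contains a cycle. -/
theorem exists_uCycle_of_walk {n : ℕ} {v : ℕ → Fin Q.nV} {e : ℕ → Fin Q.nE}
    (hj : ∀ i < n, Q.Joins (e i) (v i) (v (i + 1))) (hb : ∀ i, i + 1 < n → e i ≠ e (i + 1))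
    (hrep : ∃ i j, i < j ∧ j ≤ n ∧ v i = v j) :
    ∃ i j, i < j ∧ j ≤ n ∧ v i = v j ∧
      ∃ C : UCycle Q, C.edgeSet = {x | ∃ p, i ≤ p ∧ p < j ∧ e p = x} := by
  classical
  have hrep' : ∃ m, 1 ≤ m ∧ ∃ i, i + m ≤ n ∧ v i = v (i + m) := by
    obtain ⟨i, j, hij, hjn, h⟩ := hrep
    refine ⟨j - i, by omega, i, by omega, ?_⟩
    rw [h]; congr 1; omega
  obtain ⟨hm, i, him, hvi⟩ := Nat.find_spec hrep'
  have hmin : ∀ p q, p < q → q < Nat.find hrep' → v (i + p) ≠ v (i + q) := by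
    intro p q hpq hq h
    refine Nat.find_min hrep' (m := q - p) (by omega) ⟨by omega, i + p, by omega, ?_⟩
    rw [h]; congr 1; omega
  generalize Nat.find hrep' = m at hm him hvi hmin
  have hinj : ∀ p q, p < m → q < m → v (i + p) = v (i + q) → p = q := by
    intro p q hp hq h
    rcases lt_trichotomy p q with h' | h' | h'
    · exact absurd h (hmin p q h' hq)
    · exact h'
    · exact absurd h.symm (hmin q p h' hp)
  have hne : ∀ p q, p < q → q < m → e (i + p) ≠ e (i + q) := by
    intro p q hpq hq h
    have h1 := hj (i + p) (by omega)
    rw [h] at h1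
    rcases h1.endpoints (hj (i + q) (by omega)) with ⟨h1, -⟩ | ⟨-, h1⟩
    · exact hmin p q hpq hq h1
    · have := hinj (p + 1) q (by omega) hq h1
      subst this
      exact hb (i + p) (by omega) h
  obtain ⟨C, hC⟩ := exists_uCycle hm (v := fun p => v (i + p)) (e := fun p => e (i + p))
    (by
      intro p hp
      have h1 := hj (i + p) (by omega)
      rcases Nat.lt_or_ge (p + 1) m with h | h
      · rw [Nat.mod_eq_of_lt h]; exact h1
      · obtain rfl : p + 1 = m := by omega
        rw [Nat.mod_self, Nat.add_zero, hvi]; exact h1)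
    hinj
    (by
      intro p q hp hq h
      rcases lt_trichotomy p q with h' | h' | h'
      · exact absurd h (hne p q h' hq)
      · exact h'
      · exact absurd h.symm (hne q p h' hp))
  refine ⟨i, i + m, by omega, him, hvi, C, hC.trans ?_⟩
  ext x
  constructor
  · rintro ⟨p, hp, rfl⟩
    exact ⟨i + p, by omega, by omega, rfl⟩
  · rintro ⟨p, hp, hp', rfl⟩
    exact ⟨p - i, by omega, by congr 1; omega⟩

/-- The simple graph on the vertices whose edges come from the arrows in `X`. -/
def graphOn (Q : QuiverData) (X : Set (Fin Q.nE)) : SimpleGraph (Fin Q.nV) where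
  Adj u w := u ≠ w ∧ ∃ b ∈ X, Q.Joins b u w
  symm := ⟨fun _ _ h => ⟨h.1.symm, h.2.imp fun _ hb => ⟨hb.1, hb.2.symm⟩⟩⟩
  loopless := ⟨fun _ h => h.1 rfl⟩

theorem graphOn_mono {X Y : Set (Fin Q.nE)} (h : X ⊆ Y) : Q.graphOn X ≤ Q.graphOn Y :=
  fun _ _ hb => ⟨hb.1, hb.2.imp fun _ hb => ⟨h hb.1, hb.2⟩⟩

theorem Joins.reachable {X : Set (Fin Q.nE)} {b : Fin Q.nE} (hb : b ∈ X) {u w : Fin Q.nV}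
    (h : Q.Joins b u w) : (Q.graphOn X).Reachable u w := by
  by_cases huw : u = w
  · rw [huw]
  · exact SimpleGraph.Adj.reachable ⟨huw, b, hb, h⟩

/-- An arrow joining two vertices that are already connected closes a cycle. -/
theorem exists_uCycle_of_reachable {X : Set (Fin Q.nE)} {u w : Fin Q.nV}
    (h : (Q.graphOn X).Reachable u w) {a : Fin Q.nE} (ha : a ∉ X) (haj : Q.Joins a w u) :
    ∃ C : UCycle Q, a ∈ C.edgeSet ∧ C.edgeSet ⊆ insert a X := by
  classical
  obtain ⟨p, hp⟩ := h.exists_isPath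
  have hex : ∀ i, ∃ b, i < p.length → b ∈ X ∧ Q.Joins b (p.getVert i) (p.getVert (i + 1)) := by
    intro i
    by_cases hi : i < p.length
    · obtain ⟨-, b, hb⟩ := p.adj_getVert_succ hi
      exact ⟨b, fun _ => hb⟩
    · exact ⟨a, fun h => absurd h hi⟩
  choose f hf using hex
  let v : ℕ → Fin Q.nV := fun i => if i ≤ p.length then p.getVert i else u
  let e : ℕ → Fin Q.nE := fun i => if i < p.length then f i else a
  have hvl : ∀ i, i ≤ p.length → v i = p.getVert i := fun i hi => if_pos hi
  have hel : ∀ i, i < p.length → e i = f i := fun i hi => if_pos hi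
  have hen : e p.length = a := if_neg (lt_irrefl _)
  have hvn : v (p.length + 1) = u := if_neg (by omega)
  have hinj := hp.getVert_injOn
  obtain ⟨i, j, hij, hjn, hvij, C, hC⟩ := exists_uCycle_of_walk (n := p.length + 1) (v := v)
    (e := e)
    (by
      intro i hi
      rcases Nat.lt_or_ge i p.length with h | h
      · rw [hvl _ h.le, hvl _ h, hel _ h]; exact (hf i h).2
      · obtain rfl : i = p.length := by omega
        rw [hen, hvn, hvl _ le_rfl, p.getVert_length]
        exact haj)
    (by
      intro i hi heq
      rw [hel i (by omega)] at heq
      rcases Nat.lt_or_ge (i + 1) p.length with h | h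
      · rw [hel _ h] at heq
        have h1 := (hf i (by omega)).2
        rw [heq] at h1
        have h2 : i = i + 1 ∨ i = i + 1 + 1 := by
          rcases h1.endpoints (hf (i + 1) h).2 with ⟨h1, -⟩ | ⟨h1, -⟩
          · exact Or.inl (hinj (by simp; omega) (by simp; omega) h1)
          · exact Or.inr (hinj (by simp; omega) (by simp; omega) h1)
        omega
      · obtain h : i + 1 = p.length := by omega
        rw [h, hen] at heq
        exact ha (heq ▸ (hf i (by omega)).1))
    ⟨0, p.length + 1, by omega, le_rfl, by rw [hvn, hvl _ (Nat.zero_le _), p.getVert_zero]⟩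
  have hj : j = p.length + 1 := by
    by_contra hne
    rw [hvl i (by omega), hvl j (by omega)] at hvij
    have := hinj (by simp; omega) (by simp; omega) hvij
    omega
  subst hj
  refine ⟨C, ?_⟩
  rw [hC]
  refine ⟨⟨p.length, by omega, by omega, hen⟩, ?_⟩
  rintro _ ⟨q, -, hq, rfl⟩
  rcases Nat.lt_or_ge q p.length with h | h
  · rw [hel _ h]; exact Or.inr (hf q h).1
  · obtain rfl : q = p.length := by omega
    exact Or.inl hen

end QuiverData

end UnderlyingGraph

section CycleComponent

variable {k : Type} [Field k] {Q : QuiverData} {Rel : Set (Fin Q.nE × Fin Q.nE)}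

namespace FRCycle

variable (C : FRCycle k Q Rel)

theorem len_pos : 0 < C.len := by have := C.len3; omega

theorem arrows_mod (i : ℕ) : C.arrows (i % C.len) = C.arrows i :=
  Function.Periodic.map_mod_nat C.periodic i

theorem arrows_mem (i : ℕ) : C.arrows i ∈ C.arrowSet :=
  ⟨i % C.len, Nat.mod_lt _ C.len_pos, C.arrows_mod i⟩

/-- The vertices on a full-relational cycle. -/
def vertices : Finset (Fin Q.nV) := (Finset.range C.len).image fun i => Q.src (C.arrows i)

theorem mem_vertices {v : Fin Q.nV} : v ∈ C.vertices ↔ ∃ i, Q.src (C.arrows i) = v := by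
  simp only [vertices, Finset.mem_image, Finset.mem_range]
  constructor
  · rintro ⟨i, -, h⟩; exact ⟨i, h⟩
  · rintro ⟨i, h⟩; exact ⟨i % C.len, Nat.mod_lt _ C.len_pos, by rw [C.arrows_mod, h]⟩

theorem src_mem {a : Fin Q.nE} (ha : a ∈ C.arrowSet) : Q.src a ∈ C.vertices := by
  obtain ⟨i, -, rfl⟩ := ha
  exact C.mem_vertices.2 ⟨i, rfl⟩

theorem tgt_mem {a : Fin Q.nE} (ha : a ∈ C.arrowSet) : Q.tgt a ∈ C.vertices := by
  obtain ⟨i, -, rfl⟩ := ha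
  exact C.mem_vertices.2 ⟨i + 1, (C.comp i).symm⟩

theorem eq_mod_of_src_eq {i j : ℕ} (h : Q.src (C.arrows i) = Q.src (C.arrows j)) :
    i % C.len = j % C.len :=
  C.vinj _ _ (Nat.mod_lt _ C.len_pos) (Nat.mod_lt _ C.len_pos)
    (by rw [C.arrows_mod, C.arrows_mod, h])

theorem arrows_eq_of_src_eq {i j : ℕ} (h : Q.src (C.arrows i) = Q.src (C.arrows j)) :
    C.arrows i = C.arrows j := by
  rw [← C.arrows_mod i, ← C.arrows_mod j, C.eq_mod_of_src_eq h]

theorem arrows_add_mod (i m : ℕ) : C.arrows (i % C.len + m) = C.arrows (i + m) := by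
  rw [← C.arrows_mod, ← C.arrows_mod (i + m), Nat.mod_add_mod]

theorem eq_of_src_eq {a b : Fin Q.nE} (ha : a ∈ C.arrowSet) (hb : b ∈ C.arrowSet)
    (h : Q.src a = Q.src b) : a = b := by
  obtain ⟨i, -, rfl⟩ := ha
  obtain ⟨j, -, rfl⟩ := hb
  exact C.arrows_eq_of_src_eq h

theorem eq_of_tgt_eq {a b : Fin Q.nE} (ha : a ∈ C.arrowSet) (hb : b ∈ C.arrowSet)
    (h : Q.tgt a = Q.tgt b) : a = b := by
  obtain ⟨i, -, rfl⟩ := ha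
  obtain ⟨j, -, rfl⟩ := hb
  rw [C.comp, C.comp] at h
  have h1 := C.eq_mod_of_src_eq h
  have h2 : i + 1 + (C.len - 1) = i + C.len := by have := C.len_pos; omega
  have h3 : j + 1 + (C.len - 1) = j + C.len := by have := C.len_pos; omega
  rw [← C.periodic i, ← C.periodic j, ← h2, ← h3, ← C.arrows_add_mod (i + 1), h1, C.arrows_add_mod]

theorem inI_of_tgt_eq_src {a b : Fin Q.nE} (ha : a ∈ C.arrowSet) (hb : b ∈ C.arrowSet)
    (h : Q.tgt a = Q.src b) : inI k Q Rel (arr k Q a * arr k Q b) := by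
  obtain ⟨i, -, rfl⟩ := ha
  rw [C.comp] at h
  rw [← C.eq_of_src_eq (C.arrows_mem _) hb h]
  exact C.frel i

theorem exists_uCycle : ∃ U : UCycle Q, U.edgeSet = C.arrowSet := by
  refine QuiverData.exists_uCycle C.len_pos (v := fun i => Q.src (C.arrows i)) (e := C.arrows)
    (fun i _ => ?_) C.vinj (fun i j hi hj h => C.vinj i j hi hj (by rw [h]))
  rw [C.arrows_mod, ← C.comp]
  exact QuiverData.joins_src_tgt _

theorem edgeSet_eq (h1 : OneCycle Q) (U : UCycle Q) : U.edgeSet = C.arrowSet := by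
  obtain ⟨V, hV⟩ := C.exists_uCycle
  rw [h1.2 U V, hV]

theorem reachable_arrows (i : ℕ) :
    (Q.graphOn C.arrowSet).Reachable (Q.src (C.arrows i)) (Q.src (C.arrows 0)) := by
  induction i with
  | zero => rfl
  | succ i ih =>
    refine SimpleGraph.Reachable.trans ?_ ih
    rw [← C.comp]
    exact (QuiverData.joins_src_tgt _).symm.reachable (C.arrows_mem i)

theorem reachable {v : Fin Q.nV} (hv : v ∈ C.vertices) :
    (Q.graphOn C.arrowSet).Reachable v (Q.src (C.arrows 0)) := by
  obtain ⟨i, rfl⟩ := C.mem_vertices.1 hv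
  exact C.reachable_arrows i

theorem mem_arrowSet_of_mem_vertices (h1 : OneCycle Q) {a : Fin Q.nE} (hs : Q.src a ∈ C.vertices)
    (ht : Q.tgt a ∈ C.vertices) : a ∈ C.arrowSet := by
  by_contra ha
  obtain ⟨U, hU, -⟩ := QuiverData.exists_uCycle_of_reachable
    ((C.reachable hs).trans (C.reachable ht).symm) ha (QuiverData.joins_src_tgt a).symm
  exact ha (C.edgeSet_eq h1 U ▸ hU)

theorem joins_mem {a : Fin Q.nE} (ha : a ∈ C.arrowSet) {u w : Fin Q.nV} (h : Q.Joins a u w) :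
    u ∈ C.vertices := by
  rcases h with ⟨rfl, -⟩ | ⟨rfl, -⟩
  exacts [C.src_mem ha, C.tgt_mem ha]

theorem src_ne_tgt (C : FRCycle k Q Rel) (h1 : OneCycle Q) (a : Fin Q.nE) : Q.src a ≠ Q.tgt a := by
  intro h
  obtain ⟨U, hU, hU'⟩ := QuiverData.exists_uCycle_of_reachable (X := ∅) (u := Q.tgt a)
    (w := Q.src a)
    (by rw [h]) (Set.notMem_empty a) (QuiverData.joins_src_tgt a)
  rw [C.edgeSet_eq h1] at hU'
  have h01 : C.arrows 0 = C.arrows 1 := by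
    have h0 := hU' (C.arrows_mem 0)
    have h1 := hU' (C.arrows_mem 1)
    simp only [insert_empty_eq, Set.mem_singleton_iff] at h0 h1
    rw [h0, h1]
  have := C.vinj 0 1 C.len_pos (by have := C.len3; omega) (by rw [h01])
  omega

/-- There is a height function such that every vertex outside the cycle is incident to at most one
arrow leading to the cycle or to a vertex which is not higher. -/
theorem exists_height (h1 : OneCycle Q) : ∃ h : Fin Q.nV → ℕ, ∀ v ∉ C.vertices,
    ∀ a a' x x', Q.Joins a v x → Q.Joins a' v x' → (x ∈ C.vertices ∨ h x ≤ h v) →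
      (x' ∈ C.vertices ∨ h x' ≤ h v) → a = a' := by
  classical
  let G := Q.graphOn Set.univ
  let c := Q.src (C.arrows 0)
  let r : Fin Q.nV → Fin Q.nV := fun v =>
    if G.Reachable v c then c else (G.connectedComponentMk v).out
  have hr : ∀ v, G.Reachable v (r v) := by
    intro v
    by_cases h : G.Reachable v c
    · simp only [r, if_pos h]; exact h
    · simp only [r, if_neg h]
      exact (SimpleGraph.ConnectedComponent.exact (Quot.out_eq _)).symm
  have hrr : ∀ v w, G.Reachable v w → r v = r w := by
    intro v w h
    have h' : G.Reachable v c ↔ G.Reachable w c := ⟨h.symm.trans, h.trans⟩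
    simp only [r, h', SimpleGraph.ConnectedComponent.sound h]
  refine ⟨fun v => G.dist v (r v), fun v hv a a' x x' ha ha' hx hx' => ?_⟩
  by_contra hne
  let Y : Set (Fin Q.nE) := {b | ∀ w, ¬ Q.Joins b v w}
  have key : ∀ n x, x ≠ v → G.Reachable x (r v) → G.dist x (r v) = n →
      G.dist x (r v) ≤ G.dist v (r v) → (Q.graphOn Y).Reachable x (r v) := by
    intro n
    induction n using Nat.strong_induction_on with
    | _ n ih =>
      intro x hxv hxr hn hle
      obtain ⟨p, hp⟩ := hxr.exists_walk_length_eq_dist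
      generalize r v = ρ at p hp ih hxr hn hle ⊢
      cases p with
      | nil => rfl
      | @cons _ y _ hadj q =>
        have h2 : G.dist y ρ ≤ q.length := SimpleGraph.dist_le q
        rw [SimpleGraph.Walk.length_cons] at hp
        have hyv : y ≠ v := by rintro rfl; omega
        refine SimpleGraph.Reachable.trans ?_
          (ih _ (by omega) y hyv q.reachable rfl (by omega))
        obtain ⟨-, b, -, hb⟩ := hadj
        refine hb.reachable fun w hw => ?_
        rcases hb.endpoints hw with ⟨h, -⟩ | ⟨-, h⟩
        exacts [hxv h, hyv h]
  have hself : ∀ b y, Q.Joins b v y → y ≠ v := by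
    rintro b y hb rfl
    rcases hb with hb | hb
    exacts [C.src_ne_tgt h1 b (hb.1.trans hb.2.symm), C.src_ne_tgt h1 b (hb.2.trans hb.1.symm)]
  have hCY : C.arrowSet ⊆ Y := fun b hb w hw => hv (C.joins_mem hb hw)
  have main : ∀ b y, Q.Joins b v y → (y ∈ C.vertices ∨ G.dist y (r y) ≤ G.dist v (r v)) →
      (Q.graphOn Y).Reachable y (r v) := by
    intro b y hb hy
    have hvy : G.Reachable v y := hb.reachable (Set.mem_univ b)
    rcases hy with hy | hy
    · have h := C.reachable hy
      have hyc : G.Reachable y c := h.mono (QuiverData.graphOn_mono (Set.subset_univ _))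
      have hrc : r v = c := if_pos (hvy.trans hyc)
      rw [hrc]
      exact h.mono (QuiverData.graphOn_mono hCY)
    · rw [← hrr v y hvy] at hy
      exact key _ y (hself b y hb) (hvy.symm.trans (hr v)) rfl hy
  have hreach : (Q.graphOn (insert a' Y)).Reachable v x :=
    (ha'.reachable (Set.mem_insert _ _)).trans
      (((main a' x' ha' hx').trans (main a x ha hx).symm).mono
        (QuiverData.graphOn_mono (Set.subset_insert _ _)))
  obtain ⟨U, hU, -⟩ := QuiverData.exists_uCycle_of_reachable hreach (a := a)
    (by
      rintro (h | h)
      · exact hne h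
      · exact h x ha) ha.symm
  exact hv (C.joins_mem (C.edgeSet_eq h1 U ▸ hU) ha)

/-- In a quiver with exactly one cycle, the set of all vertices is obtained from the vertices of
the cycle by successively adding vertices which are attached by at most one arrow. -/
theorem vertex_induction (h1 : OneCycle Q) {P : Finset (Fin Q.nV) → Prop} (base : P C.vertices)
    (step : ∀ S v, P S → v ∉ S → (∀ a b, (Q.src a = v ∧ Q.tgt a ∈ S ∨ Q.tgt a = v ∧ Q.src a ∈ S) →
      (Q.src b = v ∧ Q.tgt b ∈ S ∨ Q.tgt b = v ∧ Q.src b ∈ S) → a = b) → P (insert v S)) :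
    P Finset.univ := by
  classical
  obtain ⟨h, hh⟩ := C.exists_height h1
  suffices H : ∀ n, ∀ S : Finset (Fin Q.nV), C.vertices ⊆ S → S.card = n → P S from
    H _ _ (Finset.subset_univ _) rfl
  intro n
  induction n with
  | zero =>
    intro S hS hn
    rw [Finset.card_eq_zero] at hn
    subst hn
    rwa [← Finset.subset_empty.1 hS]
  | succ n ih =>
    intro S hS hn
    rcases (S \ C.vertices).eq_empty_or_nonempty with he | he
    · rw [← Finset.Subset.antisymm hS (Finset.sdiff_eq_empty_iff_subset.1 he)]
      exact base
    obtain ⟨v, hv, hmax⟩ := Finset.exists_max_image _ h he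
    rw [Finset.mem_sdiff] at hv
    rw [← Finset.insert_erase hv.1]
    refine step _ v (ih _ (fun w hw => Finset.mem_erase.2 ⟨?_, hS hw⟩) ?_)
      (Finset.notMem_erase _ _) ?_
    · rintro rfl; exact hv.2 hw
    · rw [Finset.card_erase_of_mem hv.1, hn]; rfl
    · have hx : ∀ x ∈ S.erase v, x ∈ C.vertices ∨ h x ≤ h v := fun x hx => by
        by_cases hxC : x ∈ C.vertices
        · exact Or.inl hxC
        · exact Or.inr (hmax x (Finset.mem_sdiff.2 ⟨Finset.mem_of_mem_erase hx, hxC⟩))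
      have hj : ∀ a, (Q.src a = v ∧ Q.tgt a ∈ S.erase v ∨ Q.tgt a = v ∧ Q.src a ∈ S.erase v) →
          ∃ x, Q.Joins a v x ∧ (x ∈ C.vertices ∨ h x ≤ h v) := by
        rintro a (⟨ha, ha'⟩ | ⟨ha, ha'⟩)
        exacts [⟨_, Or.inl ⟨ha, rfl⟩, hx _ ha'⟩, ⟨_, Or.inr ⟨ha, rfl⟩, hx _ ha'⟩]
      intro a b ha hb
      obtain ⟨x, hax, hx⟩ := hj a ha
      obtain ⟨y, hby, hy⟩ := hj b hb
      exact hh v hv.2 a b x y hax hby hx hy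

end FRCycle

end CycleComponent

section GentleAlgebra

variable {k : Type} [Field k] {Q : QuiverData} {Rel : Set (Fin Q.nE × Fin Q.nE)}

theorem vtx_mul_vtx (v w : Fin Q.nV) : vtx k Q v * vtx k Q w = if v = w then vtx k Q v else 0 := by
  have h := RingQuot.mkAlgHom_rel k (PathRel.vtx_mul (k := k) v w)
  rw [map_mul] at h
  refine h.trans ?_
  split_ifs
  · rfl
  · exact map_zero _

theorem sum_vtx : ∑ v, vtx k Q v = 1 := by
  have h := RingQuot.mkAlgHom_rel k (PathRel.vtx_sum (k := k) (Q := Q))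
  rwa [map_sum, map_one] at h

theorem vtx_mul_arr (a : Fin Q.nE) : vtx k Q (Q.src a) * arr k Q a = arr k Q a := by
  have h := RingQuot.mkAlgHom_rel k (PathRel.src_arr (k := k) a)
  rwa [map_mul] at h

theorem arr_mul_vtx (a : Fin Q.nE) : arr k Q a * vtx k Q (Q.tgt a) = arr k Q a := by
  have h := RingQuot.mkAlgHom_rel k (PathRel.arr_tgt (k := k) a)
  rwa [map_mul] at h

theorem vtxA_mul_vtxA (v w : Fin Q.nV) :
    vtxA k Q Rel v * vtxA k Q Rel w = if v = w then vtxA k Q Rel v else 0 := by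
  rw [vtxA, vtxA, ← map_mul, vtx_mul_vtx]
  split_ifs
  · rfl
  · exact map_zero _

theorem vtxA_mul_self (v : Fin Q.nV) : vtxA k Q Rel v * vtxA k Q Rel v = vtxA k Q Rel v := by
  rw [vtxA_mul_vtxA, if_pos rfl]

theorem vtxA_mul_of_ne {v w : Fin Q.nV} (h : v ≠ w) : vtxA k Q Rel v * vtxA k Q Rel w = 0 := by
  rw [vtxA_mul_vtxA, if_neg h]

theorem sum_vtxA : ∑ v, vtxA k Q Rel v = 1 := by
  rw [← map_one (gmap k Q Rel), ← sum_vtx, map_sum]; rfl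

theorem vtxA_mul_arrA (a : Fin Q.nE) :
    vtxA k Q Rel (Q.src a) * arrA k Q Rel a = arrA k Q Rel a := by
  rw [vtxA, arrA, ← map_mul, vtx_mul_arr]

theorem arrA_mul_vtxA (a : Fin Q.nE) :
    arrA k Q Rel a * vtxA k Q Rel (Q.tgt a) = arrA k Q Rel a := by
  rw [vtxA, arrA, ← map_mul, arr_mul_vtx]

theorem vtxA_mul_arrA_of_ne {v : Fin Q.nV} {a : Fin Q.nE} (h : v ≠ Q.src a) :
    vtxA k Q Rel v * arrA k Q Rel a = 0 := by
  rw [← vtxA_mul_arrA, ← mul_assoc, vtxA_mul_of_ne h, zero_mul]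

theorem inI_arr_mul_arr {a b : Fin Q.nE} :
    inI k Q Rel (arr k Q a * arr k Q b) ↔ arrA k Q Rel a * arrA k Q Rel b = 0 := by
  rw [inI, map_mul]; rfl

theorem arrA_mul_arrA_of_mem {a b : Fin Q.nE} (h : (a, b) ∈ Rel) :
    arrA k Q Rel a * arrA k Q Rel b = 0 := by
  have h := RingQuot.mkAlgHom_rel k (s := GRel k Q Rel) (x := arr k Q a * arr k Q b) (y := 0)
    ⟨⟨(a, b), h, rfl⟩, rfl⟩
  rwa [map_mul, map_zero] at h

theorem adjoin_vtxA_arrA :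
    Algebra.adjoin k (Set.range (vtxA k Q Rel) ∪ Set.range (arrA k Q Rel)) = ⊤ := by
  have h1 : Function.Surjective (RingQuot.mkAlgHom k (PathRel k Q)) :=
    RingQuot.mkAlgHom_surjective _ _
  have h2 : Function.Surjective (gmap k Q Rel) := RingQuot.mkAlgHom_surjective _ _
  let φ : FreeAlgebra k (Fin Q.nV ⊕ Fin Q.nE) →ₐ[k] GAlg k Q Rel :=
    (gmap k Q Rel).comp (RingQuot.mkAlgHom k (PathRel k Q))
  have h3 : Function.Surjective φ := h2.comp h1
  rw [eq_top_iff]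
  rintro x -
  obtain ⟨z, rfl⟩ := h3 x
  induction z using FreeAlgebra.induction with
  | grade0 r =>
    rw [AlgHom.commutes]
    exact Subalgebra.algebraMap_mem _ r
  | grade1 x =>
    rcases x with v | a
    exacts [Algebra.subset_adjoin (Or.inl ⟨v, rfl⟩), Algebra.subset_adjoin (Or.inr ⟨a, rfl⟩)]
  | mul x y hx hy => rw [map_mul]; exact Subalgebra.mul_mem _ hx hy
  | add x y hx hy => rw [map_add]; exact Subalgebra.add_mem _ hx hy

/-- To prove a property of all elements of `A`, it suffices to prove it for trivial paths and
arrows and to check that it is compatible with the algebra structure. -/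
theorem GAlg.induction {p : GAlg k Q Rel → Prop} (vtx : ∀ v, p (vtxA k Q Rel v))
    (arr : ∀ a, p (arrA k Q Rel a)) (scalar : ∀ c : k, p (algebraMap k _ c))
    (sum : ∀ x y, p x → p y → p (x + y)) (mul : ∀ x y, p x → p y → p (x * y))
    (x : GAlg k Q Rel) : p x := by
  have hx : x ∈ Algebra.adjoin k (Set.range (vtxA k Q Rel) ∪ Set.range (arrA k Q Rel)) := by
    rw [adjoin_vtxA_arrA]; trivial
  induction hx using Algebra.adjoin_induction with
  | mem x hx =>
    rcases hx with ⟨v, rfl⟩ | ⟨a, rfl⟩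
    exacts [vtx v, arr a]
  | algebraMap r => exact scalar r
  | add x y _ _ hx hy => exact sum x y hx hy
  | mul x y _ _ hx hy => exact mul x y hx hy

/-- An assignment of a side to the beginning and to the end of each arrow, such that two
composable arrows meet at the same side if and only if their composite is zero. -/
structure Sides (k : Type) [Field k] (Q : QuiverData) (Rel : Set (Fin Q.nE × Fin Q.nE)) where
  outSide : Fin Q.nE → Bool
  inSide : Fin Q.nE → Bool
  outSide_inj : ∀ a b, Q.src a = Q.src b → outSide a = outSide b → a = b
  inSide_inj : ∀ a b, Q.tgt a = Q.tgt b → inSide a = inSide b → a = b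
  eq_iff : ∀ a b, Q.tgt a = Q.src b →
    (inSide a = outSide b ↔ inI k Q Rel (arr k Q a * arr k Q b))

theorem eq_of_card_le_two {α : Type*} {s : Finset α} (hs : s.card ≤ 2) {a b c : α} (ha : a ∈ s)
    (hb : b ∈ s) (hc : c ∈ s) (hb' : b ≠ a) (hc' : c ≠ a) : b = c := by
  by_contra h
  exact absurd (Finset.two_lt_card.2 ⟨a, ha, b, hb, c, hc, hb'.symm, hc'.symm, h⟩) (by omega)

theorem IsGentle.exists_sides_at (h : IsGentle k Q Rel) (v : Fin Q.nV) :
    ∃ σ τ : Fin Q.nE → Bool, (∀ a b, Q.src a = v → Q.src b = v → σ a = σ b → a = b) ∧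
      (∀ a b, Q.tgt a = v → Q.tgt b = v → τ a = τ b → a = b) ∧
      ∀ a b, Q.tgt a = v → Q.src b = v →
        (τ a = σ b ↔ inI k Q Rel (arr k Q a * arr k Q b)) := by
  classical
  by_cases hex : ∃ b₀, Q.src b₀ = v
  · obtain ⟨b₀, hb₀⟩ := hex
    refine ⟨fun b => decide (b = b₀), fun a => decide (inI k Q Rel (arr k Q a * arr k Q b₀)),
      fun a b ha hb hab => ?_, fun a b ha hb hab => ?_, fun a b ha hb => ?_⟩
    · rw [decide_eq_decide] at hab
      by_cases h' : a = b₀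
      · rw [h', hab.1 h']
      · exact eq_of_card_le_two (h.src_card v) (by simpa using hb₀) (by simpa using ha)
          (by simpa using hb) h' fun hb' => h' (hab.2 hb')
    · rw [decide_eq_decide] at hab
      by_cases h' : inI k Q Rel (arr k Q a * arr k Q b₀)
      · exact h.uniq_rel_left b₀ a b (ha.trans hb₀.symm) (hb.trans hb₀.symm) h' (hab.1 h')
      · exact h.uniq_nonrel_left b₀ a b h' (mt hab.2 h')
    · rw [decide_eq_decide]
      by_cases hbb : b = b₀
      · subst hbb; simp
      · simp only [hbb, iff_false]
        constructor
        · intro h1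
          by_contra h2
          exact hbb (h.uniq_nonrel_right a b b₀ h2 h1)
        · intro h1 h2
          exact hbb (h.uniq_rel_right a b b₀ (ha.trans hb.symm) (ha.trans hb₀.symm) h1 h2)
  · by_cases hex' : ∃ a₀, Q.tgt a₀ = v
    · obtain ⟨a₀, ha₀⟩ := hex'
      refine ⟨fun _ => true, fun a => decide (a = a₀), fun a _ ha => absurd ⟨a, ha⟩ hex,
        fun a b ha hb hab => ?_, fun _ b _ hb => absurd ⟨b, hb⟩ hex⟩
      rw [decide_eq_decide] at hab
      by_cases h' : a = a₀
      · rw [h', hab.1 h']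
      · exact eq_of_card_le_two (h.tgt_card v) (by simpa using ha₀) (by simpa using ha)
          (by simpa using hb) h' fun hb' => h' (hab.2 hb')
    · exact ⟨fun _ => true, fun _ => true, fun a _ ha => absurd ⟨a, ha⟩ hex,
        fun a _ ha => absurd ⟨a, ha⟩ hex', fun _ b _ hb => absurd ⟨b, hb⟩ hex⟩

theorem IsGentle.nonempty_sides (h : IsGentle k Q Rel) : Nonempty (Sides k Q Rel) := by
  choose σ τ h1 h2 h3 using h.exists_sides_at
  exact ⟨⟨fun a => σ (Q.src a) a, fun a => τ (Q.tgt a) a,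
    fun a b hab hs => h1 _ a b rfl hab.symm (by rw [hs, hab]),
    fun a b hab hs => h2 _ a b rfl hab.symm (by rw [hs, hab]),
    fun a b hab => by rw [← hab]; exact h3 _ a b rfl hab.symm⟩⟩

section Modules

variable {N : Type*} [AddCommGroup N] [Module (GAlg k Q Rel)ᵐᵒᵖ N]

theorem op_vtxA_smul_op_arrA_smul (a : Fin Q.nE) (x : N) :
    op (vtxA k Q Rel (Q.tgt a)) • op (arrA k Q Rel a) • x = op (arrA k Q Rel a) • x := by
  rw [smul_smul, ← op_mul, arrA_mul_vtxA]

theorem op_arrA_smul_op_arrA_smul {a b : Fin Q.nE}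
    (h : inI k Q Rel (arr k Q a * arr k Q b)) (x : N) :
    op (arrA k Q Rel b) • op (arrA k Q Rel a) • x = 0 := by
  rw [smul_smul, ← op_mul, inI_arr_mul_arr.1 h, op_zero, zero_smul]

/-- The sided representation associated with a module over a gentle algebra. -/
noncomputable def Sides.rep (s : Sides k Q Rel) (N : Type*) [AddCommGroup N] [Module k N]
    [Module (GAlg k Q Rel)ᵐᵒᵖ N] [IsScalarTower k (GAlg k Q Rel)ᵐᵒᵖ N] : SidedRep k N Q where
  space v := LinearMap.range (Algebra.lsmul k k N (op (vtxA k Q Rel v)))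
  map a := Algebra.lsmul k k N (op (arrA k Q Rel a))
  outSide := s.outSide
  inSide := s.inSide
  map_le a := by
    rintro _ ⟨x, -, rfl⟩
    exact ⟨_, op_vtxA_smul_op_arrA_smul a x⟩
  comp_eq_zero a b hab hs x := op_arrA_smul_op_arrA_smul ((s.eq_iff a b hab).1 hs) x
  outSide_inj := s.outSide_inj
  inSide_inj := s.inSide_inj

theorem Sides.hasStringBases (s : Sides k Q Rel) (C : FRCycle k Q Rel) (h1 : OneCycle Q)
    (N : Type*) [AddCommGroup N] [Module k N] [Module (GAlg k Q Rel)ᵐᵒᵖ N]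
    [IsScalarTower k (GAlg k Q Rel)ᵐᵒᵖ N] : (s.rep N).HasStringBases Finset.univ := by
  refine C.vertex_induction h1 ?_ fun S v hS hv hleaf =>
    hS.insert_vertex hv (fun a ha ha' => C.src_ne_tgt h1 a (ha.trans ha'.symm)) hleaf
  refine SidedRep.hasStringBases_of_cycle (Z := C.arrowSet)
    (fun a => C.mem_arrowSet_of_mem_vertices h1) ?_ ?_ ?_ (fun a ha b hb => C.eq_of_src_eq ha hb)
    fun a ha b hb => C.eq_of_tgt_eq ha hb
  · intro v hv
    obtain ⟨i, rfl⟩ := C.mem_vertices.1 hv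
    refine ⟨C.arrows (i + (C.len - 1)), C.arrows_mem _, C.src_mem (C.arrows_mem _), ?_⟩
    have := C.len_pos
    rw [C.comp, show i + (C.len - 1) + 1 = i + C.len by omega, C.periodic]
  · intro v hv
    obtain ⟨i, rfl⟩ := C.mem_vertices.1 hv
    exact ⟨C.arrows i, C.arrows_mem i, rfl, C.tgt_mem (C.arrows_mem i)⟩
  · exact fun a ha b hb hab => (s.eq_iff a b hab).2 (C.inI_of_tgt_eq_src ha hb hab)

/-- A basis of a module which consists of eigenvectors for the trivial paths, and on which each
arrow acts as a partial injection. -/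
structure IsPathBasis [Module k N] {ι : Type*} (b : Module.Basis ι k N) (vert : ι → Fin Q.nV) :
    Prop where
  vtx_smul : ∀ i, op (vtxA k Q Rel (vert i)) • b i = b i
  arr_smul : ∀ a i, op (arrA k Q Rel a) • b i = 0 ∨ ∃ j, op (arrA k Q Rel a) • b i = b j
  inj : ∀ a i i' j, op (arrA k Q Rel a) • b i = b j → op (arrA k Q Rel a) • b i' = b j → i = i'

theorem exists_isPathBasis (hg : IsGentle k Q Rel) (C : FRCycle k Q Rel) (h1 : OneCycle Q)
    (N : Type*) [AddCommGroup N] [Module k N] [Module (GAlg k Q Rel)ᵐᵒᵖ N]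
    [IsScalarTower k (GAlg k Q Rel)ᵐᵒᵖ N] :
    ∃ (B : Fin Q.nV → Set N) (b : Module.Basis (Σ v, B v) k N),
      IsPathBasis (Rel := Rel) b Sigma.fst := by
  classical
  obtain ⟨s⟩ := hg.nonempty_sides
  obtain ⟨B, hB, -⟩ := s.hasStringBases C h1 N (fun _ _ => ∅) ⟨by simp, by simp, by simp, by simp⟩
  have hb : ∀ v, IsBasisOf (B v) ((s.rep N).space v) := fun v => hB.basis v (Finset.mem_univ v)
  have hsub : ∀ v, ∀ x ∈ B v, op (vtxA k Q Rel v) • x = x := by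
    intro v x hx
    obtain ⟨y, rfl⟩ := (hb v).subset hx
    exact (smul_smul _ _ _).trans (by rw [← op_mul, vtxA_mul_self]; rfl)
  have hsub' : ∀ v w, v ≠ w → ∀ x ∈ B v, op (vtxA k Q Rel w) • x = 0 := by
    intro v w hvw x hx
    rw [← hsub v x hx, smul_smul, ← op_mul, vtxA_mul_of_ne hvw, op_zero, zero_smul]
  have hli : LinearIndependent k (fun i : Σ v, B v => (i.2 : N)) := by
    refine linearIndependent_iUnion_finite (f := fun v (x : B v) => (x : N))
      (fun v => (hb v).1.linearIndependent) fun v t _ hv => ?_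
    rw [Submodule.disjoint_def]
    intro x hx hx'
    have h1 : Submodule.span k (Set.range fun x : B v => (x : N)) ≤
        LinearMap.ker (Algebra.lsmul k k N (op (vtxA k Q Rel v)) - LinearMap.id) := by
      rw [Submodule.span_le]
      rintro _ ⟨y, rfl⟩
      exact sub_eq_zero.2 (hsub v y y.2)
    have h2 : ⨆ w ∈ t, Submodule.span k (Set.range fun x : B w => (x : N)) ≤
        LinearMap.ker (Algebra.lsmul k k N (op (vtxA k Q Rel v))) := by
      refine iSup₂_le fun w hw => Submodule.span_le.2 ?_
      rintro _ ⟨y, rfl⟩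
      exact hsub' w v (fun h => hv (h ▸ hw)) y y.2
    exact (sub_eq_zero.1 (h1 hx)).symm.trans (h2 hx')
  have hsp : ⊤ ≤ Submodule.span k (Set.range fun i : Σ v, B v => (i.2 : N)) := by
    rintro x -
    have hx : x = ∑ v, op (vtxA k Q Rel v) • x := by
      rw [← Finset.sum_smul, ← Finset.op_sum, sum_vtxA, op_one, one_smul]
    rw [hx]
    refine Submodule.sum_mem _ fun v _ => ?_
    have : op (vtxA k Q Rel v) • x ∈ Submodule.span k (B v) := by
      rw [(hb v).2]; exact ⟨x, rfl⟩
    exact Submodule.span_mono (fun y hy => Set.mem_range.2 ⟨⟨v, y, hy⟩, rfl⟩) this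
  have hsrc : ∀ a v, v ≠ Q.src a → ∀ x ∈ B v, op (arrA k Q Rel a) • x = 0 := by
    intro a v hv x hx
    rw [← vtxA_mul_arrA, op_mul, mul_smul, hsub' v _ hv x hx, smul_zero]
  refine ⟨B, Module.Basis.mk hli hsp, ⟨fun i => ?_, ?_, ?_⟩⟩
  · rw [Module.Basis.mk_apply]; exact hsub _ _ i.2.2
  · rintro a ⟨v, x, hx⟩
    simp only [Module.Basis.mk_apply]
    by_cases hv : v = Q.src a
    · subst hv
      rcases hB.map a (Finset.mem_univ _) (Finset.mem_univ _) x hx with h | h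
      exacts [Or.inr ⟨⟨_, _, h⟩, rfl⟩, Or.inl h]
    · exact Or.inl (hsrc a v hv x hx)
  · rintro a ⟨v, x, hx⟩ ⟨v', x', hx'⟩ j hj hj'
    have hj0 : Module.Basis.mk hli hsp j ≠ 0 := Module.Basis.ne_zero _ _
    have hv : v = Q.src a := by
      by_contra hv
      rw [← hj, Module.Basis.mk_apply] at hj0
      exact hj0 (hsrc a v hv x hx)
    have hv' : v' = Q.src a := by
      by_contra hv
      rw [← hj', Module.Basis.mk_apply] at hj0
      exact hj0 (hsrc a v' hv x' hx')
    subst hv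
    subst hv'
    have h := hB.inj a (Finset.mem_univ _) (Finset.mem_univ _) x hx x' hx'
      (by
        simp only [Module.Basis.mk_apply] at hj hj'
        exact hj.trans hj'.symm)
      (by
        simp only [Module.Basis.mk_apply] at hj hj0
        exact fun h => hj0 (hj ▸ h))
    subst h
    rfl

end Modules

end GentleAlgebra

section RepresentationFiniteness

variable {k : Type} [Field k] {Q : QuiverData} {Rel : Set (Fin Q.nE × Fin Q.nE)}
  {N : Type} [AddCommGroup N] [Module k N] [Module (GAlg k Q Rel)ᵐᵒᵖ N]

variable {ι : Type*} {b : Module.Basis ι k N} {vert : ι → Fin Q.nV}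

namespace IsPathBasis

theorem vtx_smul_of_ne (h : IsPathBasis (Rel := Rel) b vert) {i : ι} {v : Fin Q.nV}
    (hv : vert i ≠ v) : op (vtxA k Q Rel v) • b i = 0 := by
  rw [← h.vtx_smul i, smul_smul, ← op_mul, vtxA_mul_of_ne hv, op_zero, zero_smul]

theorem src_eq (h : IsPathBasis (Rel := Rel) b vert) {a : Fin Q.nE} {i j : ι}
    (hij : op (arrA k Q Rel a) • b i = b j) : Q.src a = vert i := by
  by_contra hne
  refine b.ne_zero j ?_
  rw [← hij, ← vtxA_mul_arrA, op_mul, mul_smul, h.vtx_smul_of_ne (Ne.symm hne), smul_zero]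

theorem tgt_eq (h : IsPathBasis (Rel := Rel) b vert) {a : Fin Q.nE} {i j : ι}
    (hij : op (arrA k Q Rel a) • b i = b j) : Q.tgt a = vert j := by
  by_contra hne
  refine b.ne_zero j ?_
  rw [← h.vtx_smul_of_ne (i := j) (Ne.symm hne), ← hij, op_vtxA_smul_op_arrA_smul]

end IsPathBasis

variable [IsScalarTower k (GAlg k Q Rel)ᵐᵒᵖ N]

/-- A subspace which is stable under trivial paths and arrows is a submodule. -/
def submoduleOfStable (W : Submodule k N)
    (hv : ∀ v, ∀ x ∈ W, op (vtxA k Q Rel v) • x ∈ W)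
    (ha : ∀ a, ∀ x ∈ W, op (arrA k Q Rel a) • x ∈ W) : Submodule (GAlg k Q Rel)ᵐᵒᵖ N where
  carrier := W
  add_mem' := W.add_mem
  zero_mem' := W.zero_mem
  smul_mem' r x hx := by
    induction r using MulOpposite.rec' with
    | h r =>
    induction r using GAlg.induction generalizing x with
    | vtx v => exact hv v x hx
    | arr a => exact ha a x hx
    | scalar c =>
      have : op (algebraMap k (GAlg k Q Rel) c) • x = c • x :=
        algebraMap_smul (GAlg k Q Rel)ᵐᵒᵖ c x
      rw [this]
      exact W.smul_mem c hx
    | sum r s hr hs => rw [op_add, add_smul]; exact W.add_mem (hr x hx) (hs x hx)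
    | mul r s hr hs => rw [op_mul, mul_smul]; exact hs _ (hr x hx)

/-- A linear equivalence commuting with trivial paths and arrows is an isomorphism of modules. -/
def linearEquivOfCommutes {N' : Type*} [AddCommGroup N'] [Module k N']
    [Module (GAlg k Q Rel)ᵐᵒᵖ N'] [IsScalarTower k (GAlg k Q Rel)ᵐᵒᵖ N'] (f : N ≃ₗ[k] N')
    (hv : ∀ v x, f (op (vtxA k Q Rel v) • x) = op (vtxA k Q Rel v) • f x)
    (ha : ∀ a x, f (op (arrA k Q Rel a) • x) = op (arrA k Q Rel a) • f x) :
    N ≃ₗ[(GAlg k Q Rel)ᵐᵒᵖ] N' where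
  toAddEquiv := f.toAddEquiv
  map_smul' r x := by
    change f (r • x) = r • f x
    induction r using MulOpposite.rec' with
    | h r =>
    induction r using GAlg.induction generalizing x with
    | vtx v => exact hv v x
    | arr a => exact ha a x
    | scalar c =>
      have h1 : op (algebraMap k (GAlg k Q Rel) c) • x = c • x :=
        algebraMap_smul (GAlg k Q Rel)ᵐᵒᵖ c x
      have h2 : op (algebraMap k (GAlg k Q Rel) c) • f x = c • f x :=
        algebraMap_smul (GAlg k Q Rel)ᵐᵒᵖ c (f x)
      rw [h1, h2, map_smul]
    | sum r s hr hs => rw [op_add, add_smul, add_smul, map_add, hr, hs]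
    | mul r s hr hs => rw [op_mul, mul_smul, mul_smul, hs, hr]

namespace IsPathBasis

theorem stable (h : IsPathBasis (Rel := Rel) b vert) {K : Set ι}
    (hK : ∀ a i j, i ∈ K → op (arrA k Q Rel a) • b i = b j → j ∈ K) :
    ∃ W : Submodule (GAlg k Q Rel)ᵐᵒᵖ N, (W : Set N) = Submodule.span k (b '' K) := by
  refine ⟨submoduleOfStable (Submodule.span k (b '' K)) (fun v x hx => ?_) fun a x hx => ?_, rfl⟩
  · refine (Submodule.span_le (p := (Submodule.span k (b '' K)).comap
      (Algebra.lsmul k k N (op (vtxA k Q Rel v))))).2 ?_ hx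
    rintro _ ⟨i, hi, rfl⟩
    change op (vtxA k Q Rel v) • b i ∈ Submodule.span k (b '' K)
    by_cases hv : vert i = v
    · rw [← hv, h.vtx_smul]; exact Submodule.subset_span ⟨i, hi, rfl⟩
    · rw [h.vtx_smul_of_ne hv]; exact zero_mem _
  · refine (Submodule.span_le (p := (Submodule.span k (b '' K)).comap
      (Algebra.lsmul k k N (op (arrA k Q Rel a))))).2 ?_ hx
    rintro _ ⟨i, hi, rfl⟩
    change op (arrA k Q Rel a) • b i ∈ Submodule.span k (b '' K)
    rcases h.arr_smul a i with h0 | ⟨j, hj⟩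
    · rw [h0]; exact zero_mem _
    · rw [hj]; exact Submodule.subset_span ⟨j, hK a i j hi hj, rfl⟩

/-- Indices are adjacent if an arrow maps one of the basis elements to the other. -/
def graph (_ : IsPathBasis (Rel := Rel) b vert) : SimpleGraph ι where
  Adj i j := i ≠ j ∧
    ∃ a, op (arrA k Q Rel a) • b i = b j ∨ op (arrA k Q Rel a) • b j = b i
  symm := ⟨fun _ _ h => ⟨h.1.symm, h.2.imp fun _ h => h.symm⟩⟩
  loopless := ⟨fun _ h => h.1 rfl⟩

theorem preconnected (h : IsPathBasis (Rel := Rel) b vert)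
    (hN : IsIndec (GAlg k Q Rel)ᵐᵒᵖ N) : h.graph.Preconnected := by
  intro i₀ j₀
  let K : Set ι := {j | h.graph.Reachable i₀ j}
  have hadj : ∀ a i j, op (arrA k Q Rel a) • b i = b j → h.graph.Reachable i j := by
    intro a i j hij
    by_cases he : i = j
    · rw [he]
    · exact SimpleGraph.Adj.reachable ⟨he, a, Or.inl hij⟩
  obtain ⟨W, hW⟩ := h.stable (K := K) fun a i j hi hij =>
    SimpleGraph.Reachable.trans hi (hadj a i j hij)
  obtain ⟨W', hW'⟩ := h.stable (K := Kᶜ) fun a i j hi hij hj =>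
    hi (SimpleGraph.Reachable.trans hj (hadj a i j hij).symm)
  have hcompl : IsCompl W W' := by
    refine IsCompl.of_eq ?_ ?_
    · rw [eq_bot_iff]
      rintro x ⟨hx, hx'⟩
      have hx : x ∈ Submodule.span k (b '' K) := by rw [← SetLike.mem_coe, ← hW]; exact hx
      have hx' : x ∈ Submodule.span k (b '' Kᶜ) := by rw [← SetLike.mem_coe, ← hW']; exact hx'
      exact Submodule.disjoint_def.1
        (b.linearIndependent.disjoint_span_image disjoint_compl_right) x hx hx'
    · rw [eq_top_iff]
      rintro x -
      have hx : x ∈ Submodule.span k (b '' K) ⊔ Submodule.span k (b '' Kᶜ) := by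
        rw [← Submodule.span_union, ← Set.image_union, Set.union_compl_self, Set.image_univ,
          b.span_eq]
        trivial
      obtain ⟨y, hy, z, hz, rfl⟩ := Submodule.mem_sup.1 hx
      refine Submodule.add_mem_sup ?_ ?_
      · rw [← SetLike.mem_coe, hW]; exact hy
      · rw [← SetLike.mem_coe, hW']; exact hz
  have hbK : ∀ i ∈ K, b i ∈ W := fun i hi => by
    rw [← SetLike.mem_coe, hW]; exact Submodule.subset_span ⟨i, hi, rfl⟩
  rcases hN.2 W W' hcompl with h0 | h0
  · have := hbK i₀ (SimpleGraph.Reachable.refl i₀)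
    rw [h0] at this
    exact absurd ((Submodule.mem_bot _).1 this) (b.ne_zero i₀)
  · by_contra hj
    have : b j₀ ∈ W' := by
      rw [← SetLike.mem_coe, hW']; exact Submodule.subset_span ⟨j₀, hj, rfl⟩
    rw [h0] at this
    exact absurd ((Submodule.mem_bot _).1 this) (b.ne_zero j₀)

theorem vert_injective (h : IsPathBasis (Rel := Rel) b vert) (C : FRCycle k Q Rel)
    (h1 : OneCycle Q) (hN : IsIndec (GAlg k Q Rel)ᵐᵒᵖ N) : Function.Injective vert := by
  intro i₀ j₀ hv
  by_contra hne
  obtain ⟨p, hp⟩ := (h.preconnected hN i₀ j₀).exists_isPath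
  have hpos : 0 < p.length := by
    rw [Nat.pos_iff_ne_zero]
    exact fun h0 => hne (SimpleGraph.Walk.eq_of_length_eq_zero h0)
  have hinj := hp.getVert_injOn
  have hne2 : ∀ q, q + 1 < p.length → p.getVert q ≠ p.getVert (q + 2) := by
    intro q hq heq
    have := hinj (by simp; omega) (by simp; omega) heq
    omega
  have hex : ∀ q, ∃ a, q < p.length →
      op (arrA k Q Rel a) • b (p.getVert q) = b (p.getVert (q + 1)) ∨
      op (arrA k Q Rel a) • b (p.getVert (q + 1)) = b (p.getVert q) := by
    intro q
    by_cases hq : q < p.length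
    · obtain ⟨-, a, ha⟩ := p.adj_getVert_succ hq
      exact ⟨a, fun _ => ha⟩
    · exact ⟨C.arrows 0, fun h => absurd h hq⟩
  choose e he using hex
  have hback : ∀ q, q + 1 < p.length → e q ≠ e (q + 1) := by
    intro q hq heq
    have h2 := he (q + 1) hq
    rw [← heq] at h2
    rcases he q (by omega) with h3 | h3 <;> rcases h2 with h2 | h2
    · exact C.src_ne_tgt h1 (e q) ((h.src_eq h2).trans (h.tgt_eq h3).symm)
    · exact hne2 q hq (h.inj _ _ _ _ h3 h2)
    · exact hne2 q hq (b.injective (h3.symm.trans h2))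
    · exact C.src_ne_tgt h1 (e q) ((h.src_eq h3).trans (h.tgt_eq h2).symm)
  obtain ⟨i, j, hij, hjn, -, U, hU⟩ := QuiverData.exists_uCycle_of_walk (n := p.length)
    (v := fun q => vert (p.getVert q)) (e := e)
    (fun q hq => (he q hq).elim (fun h2 => Or.inl ⟨h.src_eq h2, h.tgt_eq h2⟩)
      fun h2 => Or.inr ⟨h.tgt_eq h2, h.src_eq h2⟩)
    hback ⟨0, p.length, hpos, le_rfl, by simpa using hv⟩
  rw [C.edgeSet_eq h1] at hU
  have hmem : ∀ q, i ≤ q → q < j → e q ∈ C.arrowSet := fun q hq hq' => by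
    rw [hU]; exact ⟨q, hq, hq', rfl⟩
  have hlt : i + 1 < j := by
    by_contra hlt
    have hall : ∀ x ∈ C.arrowSet, x = e i := by
      intro x hx
      rw [hU] at hx
      obtain ⟨q, hq, hq', rfl⟩ := hx
      congr 1; omega
    have h01 : C.arrows 0 = C.arrows 1 :=
      (hall _ (C.arrows_mem 0)).trans (hall _ (C.arrows_mem 1)).symm
    have := C.vinj 0 1 C.len_pos (by have := C.len3; omega) (by rw [h01])
    omega
  have hi := hmem i le_rfl hij
  have hi' := hmem (i + 1) (by omega) hlt
  have hb := hback i (by omega)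
  rcases he i (by omega) with h2 | h2 <;> rcases he (i + 1) (by omega) with h3 | h3
  · refine b.ne_zero (p.getVert (i + 1 + 1)) ?_
    rw [← h3, ← h2]
    exact op_arrA_smul_op_arrA_smul
      (C.inI_of_tgt_eq_src hi hi' ((h.tgt_eq h2).trans (h.src_eq h3).symm)) _
  · exact hb (C.eq_of_tgt_eq hi hi' ((h.tgt_eq h2).trans (h.tgt_eq h3).symm))
  · exact hb (C.eq_of_src_eq hi hi' ((h.src_eq h2).trans (h.src_eq h3).symm))
  · refine b.ne_zero (p.getVert i) ?_
    rw [← h2, ← h3]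
    exact op_arrA_smul_op_arrA_smul
      (C.inI_of_tgt_eq_src hi' hi ((h.tgt_eq h3).trans (h.src_eq h2).symm)) _

end IsPathBasis

/-- The module `N` is thin, with support given by the vertices in `X` and the arrows in `Y`. -/
def HasThinBasis (k : Type) [Field k] {Q : QuiverData} (Rel : Set (Fin Q.nE × Fin Q.nE))
    (N : Type*) [AddCommGroup N] [Module k N]
    [Module (GAlg k Q Rel)ᵐᵒᵖ N] (X : Set (Fin Q.nV)) (Y : Set (Fin Q.nE)) : Prop :=
  ∃ b : Module.Basis X k N, IsPathBasis (Rel := Rel) b Subtype.val ∧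
    ∀ a i j, op (arrA k Q Rel a) • b i = b j ↔ a ∈ Y ∧ Q.src a = i ∧ Q.tgt a = j

theorem exists_hasThinBasis (hg : IsGentle k Q Rel) (C : FRCycle k Q Rel) (h1 : OneCycle Q)
    (hN : IsIndec (GAlg k Q Rel)ᵐᵒᵖ N) : ∃ X Y, HasThinBasis k Rel N X Y := by
  obtain ⟨B, b, hb⟩ := exists_isPathBasis hg C h1 N
  have hinj := hb.vert_injective C h1 hN
  let f := Equiv.ofInjective _ hinj
  have hf : ∀ x, (f.symm x).1 = x := fun x => congrArg Subtype.val (f.apply_symm_apply x)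
  have hb' : ∀ x, b.reindex f x = b (f.symm x) := fun x => b.reindex_apply f x
  refine ⟨_, {a | ∃ i j, op (arrA k Q Rel a) • b i = b j}, b.reindex f, ⟨?_, ?_, ?_⟩, ?_⟩
  · intro x
    rw [hb', ← hf x]
    exact hb.vtx_smul _
  · intro a x
    rw [hb']
    refine (hb.arr_smul a (f.symm x)).imp id ?_
    rintro ⟨j, hj⟩
    exact ⟨f j, by rw [hb', f.symm_apply_apply, hj]⟩
  · intro a x y z h2 h3
    rw [hb', hb'] at h2 h3
    exact f.symm.injective (hb.inj a _ _ _ h2 h3)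
  · intro a x y
    rw [hb', hb']
    constructor
    · intro h2
      exact ⟨⟨_, _, h2⟩, (hb.src_eq h2).trans (hf x), (hb.tgt_eq h2).trans (hf y)⟩
    · rintro ⟨⟨i, j, hij⟩, hx, hy⟩
      have h2 : f.symm x = i := hinj (by rw [hf, ← hx, hb.src_eq hij])
      have h3 : f.symm y = j := hinj (by rw [hf, ← hy, hb.tgt_eq hij])
      rw [h2, h3, hij]

theorem HasThinBasis.nonempty_linearEquiv {N' : Type} [AddCommGroup N'] [Module k N']
    [Module (GAlg k Q Rel)ᵐᵒᵖ N'] [IsScalarTower k (GAlg k Q Rel)ᵐᵒᵖ N'] {X : Set (Fin Q.nV)}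
    {Y : Set (Fin Q.nE)} (h : HasThinBasis k Rel N X Y) (h' : HasThinBasis k Rel N' X Y) :
    Nonempty (N ≃ₗ[(GAlg k Q Rel)ᵐᵒᵖ] N') := by
  obtain ⟨b, hb, hY⟩ := h
  obtain ⟨b', hb', hY'⟩ := h'
  let f := b.equiv b' (Equiv.refl X)
  have hf : ∀ x, f (b x) = b' x := fun x => b.equiv_apply x b' (Equiv.refl X)
  refine ⟨linearEquivOfCommutes f (fun v x => ?_) fun a x => ?_⟩
  · have : f.toLinearMap ∘ₗ Algebra.lsmul k k N (op (vtxA k Q Rel v)) =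
        Algebra.lsmul k k N' (op (vtxA k Q Rel v)) ∘ₗ f.toLinearMap := by
      refine b.ext fun i => ?_
      change f (op (vtxA k Q Rel v) • b i) = op (vtxA k Q Rel v) • f (b i)
      rw [hf]
      by_cases hi : i.1 = v
      · rw [← hi, hb.vtx_smul, hb'.vtx_smul, hf]
      · rw [hb.vtx_smul_of_ne hi, hb'.vtx_smul_of_ne hi, map_zero]
    exact LinearMap.congr_fun this x
  · have : f.toLinearMap ∘ₗ Algebra.lsmul k k N (op (arrA k Q Rel a)) =
        Algebra.lsmul k k N' (op (arrA k Q Rel a)) ∘ₗ f.toLinearMap := by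
      refine b.ext fun i => ?_
      change f (op (arrA k Q Rel a) • b i) = op (arrA k Q Rel a) • f (b i)
      rw [hf]
      rcases hb.arr_smul a i with h0 | ⟨j, hj⟩
      · rcases hb'.arr_smul a i with h0' | ⟨j, hj⟩
        · rw [h0, h0', map_zero]
        · rw [(hY a i j).2 ((hY' a i j).1 hj)] at h0
          exact absurd h0 (b.ne_zero j)
      · rw [hj, hf, (hY' a i j).2 ((hY a i j).1 hj)]
    exact LinearMap.congr_fun this x

theorem repFinite_of_frCycle (hg : IsGentle k Q Rel) (C : FRCycle k Q Rel) (h1 : OneCycle Q) :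
    RepFinite (GAlg k Q Rel)ᵐᵒᵖ := by
  classical
  let P : (Set (Fin Q.nV) × Set (Fin Q.nE)) → ModuleCat.{0} (GAlg k Q Rel)ᵐᵒᵖ → Prop :=
    fun d N => letI := Module.compHom N (algebraMap k (GAlg k Q Rel)ᵐᵒᵖ)
      HasThinBasis k Rel N d.1 d.2
  let M : (Set (Fin Q.nV) × Set (Fin Q.nE)) → ModuleCat.{0} (GAlg k Q Rel)ᵐᵒᵖ := fun d =>
    if h : ∃ N, P d N then h.choose else ModuleCat.of _ PUnit
  let g := Finite.equivFin (Set (Fin Q.nV) × Set (Fin Q.nE))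
  refine ⟨_, fun i => M (g.symm i), fun N _ hN => ?_⟩
  have hex : ∃ d, P d N := by
    let _ := Module.compHom N (algebraMap k (GAlg k Q Rel)ᵐᵒᵖ)
    have : IsScalarTower k (GAlg k Q Rel)ᵐᵒᵖ N := IsScalarTower.of_algebraMap_smul fun _ _ => rfl
    obtain ⟨X, Y, h⟩ := exists_hasThinBasis hg C h1 (N := N) hN
    exact ⟨(X, Y), h⟩
  obtain ⟨d, hd⟩ := hex
  obtain ⟨i, rfl⟩ := g.symm.surjective d
  refine ⟨i, ?_⟩
  have hex : ∃ N, P (g.symm i) N := ⟨N, hd⟩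
  have hM : P (g.symm i) (M (g.symm i)) := by
    simp only [M, dif_pos hex]; exact hex.choose_spec
  let _ := Module.compHom N (algebraMap k (GAlg k Q Rel)ᵐᵒᵖ)
  let _ := Module.compHom (M (g.symm i)) (algebraMap k (GAlg k Q Rel)ᵐᵒᵖ)
  have : IsScalarTower k (GAlg k Q Rel)ᵐᵒᵖ N := IsScalarTower.of_algebraMap_smul fun _ _ => rfl
  have : IsScalarTower k (GAlg k Q Rel)ᵐᵒᵖ (M (g.symm i)) :=
    IsScalarTower.of_algebraMap_smul fun _ _ => rfl
  exact HasThinBasis.nonempty_linearEquiv (N := N) (N' := M (g.symm i)) hd hM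

end RepresentationFiniteness

section ProjectiveDimension

open CategoryTheory

/-- The module `M` has projective dimension less than `n`. -/
def PdLT (S M : Type) [Ring S] [AddCommGroup M] [Module S M] (n : ℕ) : Prop :=
  HasProjectiveDimensionLT (ModuleCat.of S M) n

namespace PdLT

variable {S M M' M'' : Type} [Ring S] [AddCommGroup M] [Module S M] [AddCommGroup M'] [Module S M']
  [AddCommGroup M''] [Module S M''] {m n : ℕ}

theorem mono (h : PdLT S M m) (hmn : m ≤ n) : PdLT S M n :=
  have : HasProjectiveDimensionLT (ModuleCat.of S M) m := h
  hasProjectiveDimensionLT_of_ge _ m n hmn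

theorem of_equiv (h : PdLT S M n) (e : M ≃ₗ[S] M') : PdLT S M' n :=
  have : HasProjectiveDimensionLT (ModuleCat.of S M) n := h
  hasProjectiveDimensionLT_of_iso e.toModuleIso n

theorem one_iff : PdLT S M 1 ↔ Module.Projective S M := by
  rw [IsProjective.iff_projective, projective_iff_hasProjectiveDimensionLT_one]; rfl

theorem of_subsingleton [Subsingleton M] (n : ℕ) : PdLT S M n :=
  mono (m := 0) (ModuleCat.isZero_of_subsingleton (ModuleCat.of S M)).hasProjectiveDimensionLT_zero
    (Nat.zero_le n)

variable {f : M →ₗ[S] M'} {g : M' →ₗ[S] M''}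

theorem shortExact (hf : Function.Injective f) (hfg : Function.Exact f g)
    (hg : Function.Surjective g) :
    (ModuleCat.shortComplexOfCompEqZero f g hfg.linearMap_comp_eq_zero).ShortExact :=
  ModuleCat.shortComplex_shortExact _ hfg hf hg

theorem middle (hf : Function.Injective f) (hfg : Function.Exact f g)
    (hg : Function.Surjective g) (h : PdLT S M n) (h'' : PdLT S M'' n) : PdLT S M' n :=
  (shortExact hf hfg hg).hasProjectiveDimensionLT_X₂ n h h''

theorem right (hf : Function.Injective f) (hfg : Function.Exact f g)
    (hg : Function.Surjective g) (h : PdLT S M n) (h' : PdLT S M' (n + 1)) : PdLT S M'' (n + 1) :=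
  (shortExact hf hfg hg).hasProjectiveDimensionLT_X₃ n h h'

theorem left (hf : Function.Injective f) (hfg : Function.Exact f g)
    (hg : Function.Surjective g) (h' : PdLT S M' n) (h'' : PdLT S M'' (n + 1)) : PdLT S M n :=
  (shortExact hf hfg hg).hasProjectiveDimensionLT_X₁ n h' h''

theorem of_surjective (hg : Function.Surjective g) (h : PdLT S (LinearMap.ker g) n)
    [Module.Projective S M'] : PdLT S M'' (n + 1) :=
  right (LinearMap.ker g).injective_subtype (fun x => by simp) hg h
    ((one_iff.2 inferInstance).mono (by omega))

theorem ker (hg : Function.Surjective g) (h : PdLT S M'' (n + 2)) [Module.Projective S M'] :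
    PdLT S (LinearMap.ker g) (n + 1) :=
  left (LinearMap.ker g).injective_subtype (fun x => by simp) hg
    ((one_iff.2 inferInstance).mono (by omega)) h

theorem prod (h : PdLT S M n) (h' : PdLT S M' n) : PdLT S (M × M') n :=
  middle (f := LinearMap.inl S M M') (g := LinearMap.snd S M M') LinearMap.inl_injective
    .inl_snd LinearMap.snd_surjective h h'

theorem sup {N N' : Submodule S M} (hd : Disjoint N N') (h : PdLT S N n) (h' : PdLT S N' n) :
    PdLT S (N ⊔ N' : Submodule S M) n := by
  let f := N.subtype.coprod N'.subtype
  have hf : Function.Injective f := by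
    rw [← LinearMap.ker_eq_bot]
    rw [LinearMap.ker_coprod_of_disjoint_range _ _ (by simpa using hd)]
    simp
  refine (h.prod h').of_equiv ((LinearEquiv.ofInjective f hf).trans (LinearEquiv.ofEq _ _ ?_))
  simp [f, LinearMap.range_coprod]

theorem finset_sup {ι : Type*} {f : ι → Submodule S M} (hi : iSupIndep f)
    (h : ∀ i, PdLT S (f i) n) (s : Finset ι) : PdLT S (s.sup f : Submodule S M) n := by
  classical
  induction s using Finset.induction_on with
  | empty =>
    rw [Finset.sup_empty]
    exact of_subsingleton n
  | insert i s his ih =>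
    rw [Finset.sup_insert]
    exact sup (hi.supIndep' (insert i s) (Finset.subset_insert i s) (Finset.mem_insert_self i s)
      his) (h i) ih

theorem of_isFiniteLength (h : ∀ (M : Type) [AddCommGroup M] [Module S M], IsSimpleModule S M →
    PdLT S M n) (hM : IsFiniteLength S M) : PdLT S M n := by
  induction hM with
  | of_subsingleton => exact of_subsingleton n
  | @of_simple_quotient M _ _ N _ _ ih =>
    exact middle (f := N.subtype) (g := N.mkQ) N.injective_subtype
      (by rw [LinearMap.exact_iff]; simp) N.mkQ_surjective ih (h _ inferInstance)

/-- If the projective dimension of finitely generated modules is bounded, then the images in an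
exact complex of finitely generated projective modules are projective. -/
theorem projective_range {P : ℤ → ModuleCat.{0} S} (d : (n : ℤ) → (P n →ₗ[S] P (n + 1)))
    [∀ n, Module.Projective S (P n)]
    (hd : ∀ n, LinearMap.range (d n) = LinearMap.ker (d (n + 1)))
    (h : ∀ j, PdLT S (LinearMap.range (d j)) n) (j : ℤ) :
    Module.Projective S (LinearMap.range (d j)) := by
  rw [← one_iff]
  induction n generalizing j with
  | zero => exact (h j).mono (Nat.zero_le 1)
  | succ n ih =>
    rcases n with - | n
    · exact h j
    · refine ih (fun j => ?_) j
      refine (ker (LinearMap.surjective_rangeRestrict (d (j + 1))) (h (j + 1))).of_equiv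
        (LinearEquiv.ofEq _ _ ?_)
      rw [LinearMap.ker_rangeRestrict, hd]

end PdLT

end ProjectiveDimension

section ArrowIdeals

variable {k : Type} [Field k] {Q : QuiverData} {Rel : Set (Fin Q.nE × Fin Q.nE)}

/-- The universal property of `kQ/I`. -/
theorem GAlg.exists_algHom {B : Type*} [Ring B] [Algebra k B] (ε : Fin Q.nV → B) (α : Fin Q.nE → B)
    (hε : ∀ v w, ε v * ε w = if v = w then ε v else 0) (hsum : ∑ v, ε v = 1)
    (hsrc : ∀ a, ε (Q.src a) * α a = α a) (htgt : ∀ a, α a * ε (Q.tgt a) = α a)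
    (hrel : ∀ p ∈ Rel, α p.1 * α p.2 = 0) :
    ∃ Φ : GAlg k Q Rel →ₐ[k] B, (∀ v, Φ (vtxA k Q Rel v) = ε v) ∧
      ∀ a, Φ (arrA k Q Rel a) = α a := by
  let φ : FreeAlgebra k (Fin Q.nV ⊕ Fin Q.nE) →ₐ[k] B := FreeAlgebra.lift k (Sum.elim ε α)
  have hφv : ∀ v, φ (FreeAlgebra.ι k (Sum.inl v)) = ε v := fun v => by simp [φ]
  have hφa : ∀ a, φ (FreeAlgebra.ι k (Sum.inr a)) = α a := fun a => by simp [φ]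
  let ψ : PathAlg k Q →ₐ[k] B := RingQuot.liftAlgHom k ⟨φ, fun x y hxy => by
    induction hxy with
    | vtx_mul v w =>
      rw [map_mul, hφv, hφv, hε]
      split_ifs
      · rw [hφv]
      · rw [map_zero]
    | vtx_sum => simp [hφv, hsum]
    | src_arr e => rw [map_mul, hφv, hφa, hsrc]
    | arr_tgt e => rw [map_mul, hφv, hφa, htgt]⟩
  have hψv : ∀ v, ψ (vtx k Q v) = ε v := fun v =>
    (RingQuot.liftAlgHom_mkAlgHom_apply k φ _ _).trans (hφv v)
  have hψa : ∀ a, ψ (arr k Q a) = α a := fun a =>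
    (RingQuot.liftAlgHom_mkAlgHom_apply k φ _ _).trans (hφa a)
  have hψ : ∀ ⦃x y⦄, GRel k Q Rel x y → ψ x = ψ y := by
    rintro _ _ ⟨⟨p, hp, rfl⟩, rfl⟩
    rw [map_mul, hψa, hψa, hrel p hp, map_zero]
  exact ⟨RingQuot.liftAlgHom k ⟨ψ, hψ⟩,
    fun v => (RingQuot.liftAlgHom_mkAlgHom_apply k ψ _ _).trans (hψv v),
    fun a => (RingQuot.liftAlgHom_mkAlgHom_apply k ψ _ _).trans (hψa a)⟩

/-- The right ideal generated by the arrows that annihilate `a` from the right. -/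
def relIdeal (k : Type) [Field k] {Q : QuiverData} (Rel : Set (Fin Q.nE × Fin Q.nE))
    (a : Fin Q.nE) : Submodule (GAlg k Q Rel)ᵐᵒᵖ (GAlg k Q Rel) :=
  ⨆ d ∈ {d | (a, d) ∈ Rel}, rIdeal (GAlg k Q Rel) (arrA k Q Rel d)

theorem arrA_mem_rIdeal (a : Fin Q.nE) : arrA k Q Rel a ∈ rIdeal (GAlg k Q Rel) (arrA k Q Rel a) :=
  Submodule.mem_span_singleton_self _

theorem mem_rIdeal {R : Type} [Ring R] {x y : R} : y ∈ rIdeal R x ↔ ∃ z, x * z = y := by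
  rw [rIdeal, Submodule.mem_span_singleton]
  exact ⟨fun ⟨r, hr⟩ => ⟨r.unop, hr⟩, fun ⟨z, hz⟩ => ⟨op z, hz⟩⟩

theorem mul_mem_of_mem {R : Type} [Ring R] {J : Submodule Rᵐᵒᵖ R} {x : R} (hx : x ∈ J) (y : R) :
    x * y ∈ J := J.smul_mem (op y) hx

theorem arrA_mul_of_mem_relIdeal {a : Fin Q.nE} {x : GAlg k Q Rel} (hx : x ∈ relIdeal k Rel a) :
    arrA k Q Rel a * x = 0 := by
  have : relIdeal k Rel a ≤
      LinearMap.ker (LinearMap.mulLeft (GAlg k Q Rel)ᵐᵒᵖ (arrA k Q Rel a)) := by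
    refine iSup₂_le fun d hd => ?_
    intro y hy
    obtain ⟨z, rfl⟩ := mem_rIdeal.1 hy
    rw [LinearMap.mem_ker, LinearMap.mulLeft_apply, ← mul_assoc,
      arrA_mul_arrA_of_mem (show (a, d) ∈ Rel from hd), zero_mul]
  exact LinearMap.mem_ker.1 (this hx)

/-- Removing the arrow `a` from the front of a path. -/
theorem exists_linearMap_arrA_mul (hg : IsGentle k Q Rel) (a : Fin Q.nE) :
    ∃ D : GAlg k Q Rel →+ GAlg k Q Rel ⧸ relIdeal k Rel a,
      (∀ x, D (arrA k Q Rel a * x) = Submodule.Quotient.mk (vtxA k Q Rel (Q.tgt a) * x)) ∧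
      ∀ c, c ≠ a → ∀ x, D (arrA k Q Rel c * x) = 0 := by
  classical
  let A := GAlg k Q Rel
  let M := A ⧸ relIdeal k Rel a
  let r (x : A) : Module.End k M := Algebra.lsmul k k M (op x)
  have hr : ∀ x y, r (x * y) = r y * r x := fun x y => by
    simp only [r, op_mul, map_mul]
  have hr1 : r 1 = 1 := by simp only [r, op_one, map_one]
  have hr0 : r 0 = 0 := by simp only [r, op_zero, map_zero]
  have hrsum : ∀ f : Fin Q.nV → A, r (∑ v, f v) = ∑ v, r (f v) := fun f => by
    simp only [r, Finset.op_sum, map_sum]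
  let m (x : A) : M := Submodule.Quotient.mk x
  have hm : ∀ x y, r y (m x) = m (x * y) := fun x y => rfl
  let w := Q.tgt a
  let ε (v : Fin Q.nV) : Module.End k (M × k) :=
    (r (vtxA k Q Rel v)).prodMap (if v = Q.src a then 1 else 0)
  let α (c : Fin Q.nE) : Module.End k (M × k) :=
    LinearMap.prod ((r (arrA k Q Rel c)).comp (LinearMap.fst k M k) +
      if c = a then (LinearMap.toSpanSingleton k M (m (vtxA k Q Rel w))).comp
        (LinearMap.snd k M k) else 0) 0
  have hε : ∀ v y t, ε v (y, t) = (r (vtxA k Q Rel v) y, if v = Q.src a then t else 0) := by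
    intro v y t
    simp only [ε, LinearMap.prodMap_apply]
    split_ifs <;> rfl
  have hα : ∀ c y t, α c (y, t) =
      (r (arrA k Q Rel c) y + if c = a then t • m (vtxA k Q Rel w) else 0, 0) := by
    intro c y t
    simp only [α, LinearMap.prod_apply]
    split_ifs <;> rfl
  obtain ⟨Φ, hΦv, hΦa⟩ := GAlg.exists_algHom (k := k) (Rel := Rel) (fun v => op (ε v))
    (fun c => op (α c))
    (fun v u => by
      rw [← op_mul]
      have : ε u * ε v = if v = u then ε v else 0 := by
        refine LinearMap.ext fun ⟨y, t⟩ => ?_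
        rw [Module.End.mul_apply, hε, hε, ← Module.End.mul_apply, ← hr, vtxA_mul_vtxA]
        by_cases hvu : v = u
        · subst hvu
          rw [if_pos rfl, if_pos rfl, hε]
          split_ifs <;> rfl
        · rw [if_neg hvu, if_neg hvu, hr0]
          refine Prod.ext rfl ?_
          dsimp only
          split_ifs with h1 h2
          · exact absurd (h2.trans h1.symm) hvu
          all_goals rfl
      rw [this]
      split_ifs <;> rfl)
    (by
      rw [← op_one, ← Finset.op_sum]
      congr 1
      refine LinearMap.ext fun ⟨y, t⟩ => ?_
      rw [LinearMap.sum_apply]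
      simp only [hε]
      refine Prod.ext ?_ ?_
      · rw [Prod.fst_sum]
        simp only
        rw [← LinearMap.sum_apply, ← hrsum, sum_vtxA, hr1]; rfl
      · rw [Prod.snd_sum]
        simp)
    (fun c => by
      rw [← op_mul]
      congr 1
      refine LinearMap.ext fun ⟨y, t⟩ => ?_
      rw [Module.End.mul_apply, hε, hα, hα, ← Module.End.mul_apply, ← hr, vtxA_mul_arrA]
      by_cases hc : c = a
      · rw [hc, if_pos rfl, if_pos rfl, if_pos rfl]
      · rw [if_neg hc, if_neg hc])
    (fun c => by
      rw [← op_mul]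
      congr 1
      refine LinearMap.ext fun ⟨y, t⟩ => ?_
      rw [Module.End.mul_apply, hα, hε, map_add, ← Module.End.mul_apply, ← hr, arrA_mul_vtxA,
        ite_self]
      by_cases hc : c = a
      · rw [hc, if_pos rfl, map_smul, hm, vtxA_mul_self]
      · rw [if_neg hc, map_zero])
    (fun p hp => by
      rw [← op_mul, ← op_zero]
      congr 1
      refine LinearMap.ext fun ⟨y, t⟩ => ?_
      rw [Module.End.mul_apply, hα, hα, map_add, ← Module.End.mul_apply, ← hr,
        arrA_mul_arrA_of_mem hp, hr0, zero_smul, ite_self, add_zero, LinearMap.zero_apply, zero_add]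
      by_cases hc : p.1 = a
      · have hm0 : m (arrA k Q Rel p.2) = 0 := by
          refine (Submodule.Quotient.mk_eq_zero _).2 ?_
          refine Submodule.mem_iSup_of_mem p.2 (Submodule.mem_iSup_of_mem ?_ (arrA_mem_rIdeal _))
          change (a, p.2) ∈ Rel
          rw [← hc]; exact hp
        have hw : w = Q.src p.2 := by rw [← hg.comp_rel p hp, hc]
        rw [if_pos hc, map_smul, hm, hw, vtxA_mul_arrA, hm0, smul_zero]
        rfl
      · rw [if_neg hc, map_zero]; rfl)
  have h0 : ∀ x y, (Φ x).unop (y, 0) = (r x y, 0) := by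
    intro x
    induction x using GAlg.induction with
    | vtx v => intro y; rw [hΦv, unop_op, hε, ite_self]
    | arr c => intro y; rw [hΦa, unop_op, hα, zero_smul, ite_self, add_zero]
    | scalar c =>
      intro y
      rw [AlgHom.commutes]
      exact Prod.ext (algebraMap_smul Aᵐᵒᵖ c y).symm (smul_zero c)
    | sum x y hx hy => 
      intro z
      rw [map_add, unop_add, LinearMap.add_apply, hx, hy]
      simp [r, map_add]
    | mul x y hx hy => 
      intro z
      rw [map_mul, unop_mul, Module.End.mul_apply, hx, hy, hr]; rfl
  refine ⟨⟨⟨fun x => ((Φ x).unop (0, 1)).1, by simp⟩, fun x y => by simp⟩, fun x => ?_,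
    fun c hc x => ?_⟩
  · change ((Φ _).unop (0, 1)).1 = _
    rw [map_mul, unop_mul, Module.End.mul_apply, hΦa, unop_op, hα, if_pos rfl, map_zero, zero_add,
      one_smul, h0]
    rfl
  · change ((Φ _).unop (0, 1)).1 = _
    rw [map_mul, unop_mul, Module.End.mul_apply, hΦa, unop_op, hα, if_neg hc, map_zero, zero_add,
      h0, map_zero]

end ArrowIdeals

section ProjectiveResolutions

variable {k : Type} [Field k] {Q : QuiverData} {Rel : Set (Fin Q.nE × Fin Q.nE)}

theorem vtxA_mul_mem_relIdeal (hg : IsGentle k Q Rel) {a : Fin Q.nE} {x : GAlg k Q Rel}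
    (hx : arrA k Q Rel a * x = 0) : vtxA k Q Rel (Q.tgt a) * x ∈ relIdeal k Rel a := by
  obtain ⟨D, hD, -⟩ := exists_linearMap_arrA_mul hg a
  rw [← Submodule.Quotient.mk_eq_zero, ← hD, hx, map_zero]

theorem iSupIndep_rIdeal_arrA (hg : IsGentle k Q Rel) :
    iSupIndep fun a => rIdeal (GAlg k Q Rel) (arrA k Q Rel a) := by
  refine fun a => Submodule.disjoint_def.2 fun x hx hx' => ?_
  obtain ⟨D, hD, hD'⟩ := exists_linearMap_arrA_mul hg a
  have h0 : D x = 0 := by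
    refine Submodule.iSup_induction _ (motive := fun x => D x = 0) hx' (fun c y hy => ?_)
      (map_zero D) fun y z hy hz => by rw [map_add, hy, hz, add_zero]
    refine Submodule.iSup_induction _ (motive := fun x => D x = 0) hy (fun hc y hy => ?_)
      (map_zero D) fun y z hy hz => by rw [map_add, hy, hz, add_zero]
    obtain ⟨z, rfl⟩ := mem_rIdeal.1 hy
    exact hD' c hc z
  obtain ⟨z, rfl⟩ := mem_rIdeal.1 hx
  rw [hD, Submodule.Quotient.mk_eq_zero] at h0
  rw [← arrA_mul_of_mem_relIdeal h0, ← mul_assoc, arrA_mul_vtxA]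

theorem mem_rIdeal_vtxA {v : Fin Q.nV} {x : GAlg k Q Rel} :
    x ∈ rIdeal (GAlg k Q Rel) (vtxA k Q Rel v) ↔ vtxA k Q Rel v * x = x := by
  rw [mem_rIdeal]
  refine ⟨?_, fun h => ⟨x, h⟩⟩
  rintro ⟨z, rfl⟩
  rw [← mul_assoc, vtxA_mul_self]

instance projective_rIdeal_vtxA (v : Fin Q.nV) :
    Module.Projective (GAlg k Q Rel)ᵐᵒᵖ (rIdeal (GAlg k Q Rel) (vtxA k Q Rel v)) := by
  have : Module.Projective (GAlg k Q Rel)ᵐᵒᵖ (GAlg k Q Rel) :=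
    Module.Projective.of_equiv (opLinearEquiv (GAlg k Q Rel)ᵐᵒᵖ).symm
  refine Module.Projective.of_split (M := GAlg k Q Rel) (Submodule.subtype _)
    ((LinearMap.mulLeft (GAlg k Q Rel)ᵐᵒᵖ (vtxA k Q Rel v)).codRestrict _
      fun x => mem_rIdeal.2 ⟨x, rfl⟩) ?_
  ext ⟨x, hx⟩
  exact mem_rIdeal_vtxA.1 hx

theorem relIdeal_le (hg : IsGentle k Q Rel) (a : Fin Q.nE) :
    relIdeal k Rel a ≤ rIdeal (GAlg k Q Rel) (vtxA k Q Rel (Q.tgt a)) := by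
  refine iSup₂_le fun d hd => ?_
  intro y hy
  obtain ⟨z, rfl⟩ := mem_rIdeal.1 hy
  rw [mem_rIdeal_vtxA, hg.comp_rel (a, d) hd, ← mul_assoc, vtxA_mul_arrA]

theorem pdLT_rIdeal_arrA (hg : IsGentle k Q Rel) {a : Fin Q.nE} {n : ℕ}
    (h : PdLT (GAlg k Q Rel)ᵐᵒᵖ (relIdeal k Rel a) n) :
    PdLT (GAlg k Q Rel)ᵐᵒᵖ (rIdeal (GAlg k Q Rel) (arrA k Q Rel a)) (n + 1) := by
  let g := (LinearMap.mulLeft (GAlg k Q Rel)ᵐᵒᵖ (arrA k Q Rel a)).restrict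
    (p := rIdeal (GAlg k Q Rel) (vtxA k Q Rel (Q.tgt a)))
    (q := rIdeal (GAlg k Q Rel) (arrA k Q Rel a)) fun x _ => mem_rIdeal.2 ⟨x, rfl⟩
  refine PdLT.of_surjective (g := g) ?_ (h.of_equiv
    ((Submodule.submoduleOfEquivOfLe (relIdeal_le hg a)).symm.trans (LinearEquiv.ofEq _ _ ?_)))
  · rintro ⟨y, hy⟩
    obtain ⟨z, rfl⟩ := mem_rIdeal.1 hy
    refine ⟨⟨_, mem_rIdeal.2 ⟨z, rfl⟩⟩, Subtype.ext ?_⟩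
    change arrA k Q Rel a * (vtxA k Q Rel _ * z) = _
    rw [← mul_assoc, arrA_mul_vtxA]
  · ext ⟨x, hx⟩
    rw [LinearMap.mem_ker, Submodule.submoduleOf, Submodule.mem_comap, ← Subtype.coe_inj]
    change x ∈ _ ↔ arrA k Q Rel a * x = 0
    refine ⟨arrA_mul_of_mem_relIdeal, fun h0 => ?_⟩
    rw [← mem_rIdeal_vtxA.1 hx]
    exact vtxA_mul_mem_relIdeal hg h0

theorem inI_of_mem {a b : Fin Q.nE} (h : (a, b) ∈ Rel) : inI k Q Rel (arr k Q a * arr k Q b) :=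
  inI_arr_mul_arr.2 (arrA_mul_arrA_of_mem h)

theorem exists_rel_of_not_pdLT (hg : IsGentle k Q Rel) {a : Fin Q.nE}
    (h : ∀ n, ¬ PdLT (GAlg k Q Rel)ᵐᵒᵖ (rIdeal (GAlg k Q Rel) (arrA k Q Rel a)) n) :
    ∃ d, (a, d) ∈ Rel ∧
      ∀ n, ¬ PdLT (GAlg k Q Rel)ᵐᵒᵖ (rIdeal (GAlg k Q Rel) (arrA k Q Rel d)) n := by
  by_cases hex : ∃ d, (a, d) ∈ Rel
  · obtain ⟨d, hd⟩ := hex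
    refine ⟨d, hd, fun n hn => h (n + 1) (pdLT_rIdeal_arrA hg ?_)⟩
    have : relIdeal k Rel a = rIdeal (GAlg k Q Rel) (arrA k Q Rel d) := by
      refine le_antisymm (iSup₂_le fun d' hd' => ?_) (le_iSup₂_of_le d hd le_rfl)
      have hd' : (a, d') ∈ Rel := hd'
      rw [hg.uniq_rel_right a d' d (hg.comp_rel _ hd') (hg.comp_rel _ hd) (inI_of_mem hd')
        (inI_of_mem hd)]
    rw [this]
    exact hn
  · refine absurd (pdLT_rIdeal_arrA hg (n := 0) ?_) (h 1)
    have : relIdeal k Rel a = ⊥ := by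
      rw [eq_bot_iff]
      exact iSup₂_le fun d hd => absurd ⟨d, hd⟩ hex
    rw [this]
    exact PdLT.of_subsingleton 0

/-- The radical of the indecomposable projective module at `v`. -/
def vtxRad (k : Type) [Field k] {Q : QuiverData} (Rel : Set (Fin Q.nE × Fin Q.nE))
    (v : Fin Q.nV) : Submodule (GAlg k Q Rel)ᵐᵒᵖ (GAlg k Q Rel) :=
  (Finset.univ.filter fun a => Q.src a = v).sup fun a => rIdeal (GAlg k Q Rel) (arrA k Q Rel a)

theorem mul_mem_vtxRad (a : Fin Q.nE) (x : GAlg k Q Rel) :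
    arrA k Q Rel a * x ∈ vtxRad k Rel (Q.src a) := by
  have : rIdeal (GAlg k Q Rel) (arrA k Q Rel a) ≤ vtxRad k Rel (Q.src a) :=
    Finset.le_sup (f := fun a => rIdeal (GAlg k Q Rel) (arrA k Q Rel a)) (by simp)
  exact this (mem_rIdeal.2 ⟨x, rfl⟩)

theorem exists_vtxA_mul_eq (v : Fin Q.nV) (x : GAlg k Q Rel) :
    ∃ c : k, ∃ r ∈ vtxRad k Rel v, vtxA k Q Rel v * x = c • vtxA k Q Rel v + r := by
  induction x using GAlg.induction with
  | vtx w =>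
    rw [vtxA_mul_vtxA]
    split_ifs
    · exact ⟨1, 0, zero_mem _, by simp⟩
    · exact ⟨0, 0, zero_mem _, by simp⟩
  | arr a =>
    refine ⟨0, vtxA k Q Rel v * arrA k Q Rel a, ?_, by simp⟩
    by_cases h : v = Q.src a
    · rw [h, vtxA_mul_arrA, ← mul_one (arrA k Q Rel a)]
      exact mul_mem_vtxRad a 1
    · rw [vtxA_mul_arrA_of_ne h]
      exact zero_mem _
  | scalar c => exact ⟨c, 0, zero_mem _, by rw [← Algebra.commutes, ← Algebra.smul_def, add_zero]⟩
  | sum x y hx hy =>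
    obtain ⟨c, r, hr, hx⟩ := hx
    obtain ⟨d, s, hs, hy⟩ := hy
    exact ⟨c + d, r + s, add_mem hr hs, by rw [mul_add, hx, hy, add_smul]; abel⟩
  | mul x y hx hy =>
    obtain ⟨c, r, hr, hx⟩ := hx
    obtain ⟨d, s, hs, hy⟩ := hy
    refine ⟨c * d, c • s + r * y, add_mem ?_ (mul_mem_of_mem hr y), ?_⟩
    · rw [Algebra.smul_def, Algebra.commutes]
      exact mul_mem_of_mem hs _
    · rw [← mul_assoc, hx, add_mul, smul_mul_assoc, hy, smul_add, mul_smul, add_assoc]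

section Modules

variable {M : Type} [AddCommGroup M] [Module (GAlg k Q Rel)ᵐᵒᵖ M]

theorem exists_annihilated (hg : IsGentle k Q Rel) [Nontrivial M] :
    ∃ m : M, m ≠ 0 ∧ ∀ a, op (arrA k Q Rel a) • m = 0 := by
  by_contra! hcon
  obtain ⟨m, -, hm⟩ := hg.admissible
  have key : ∀ n (x : M), x ≠ 0 → ∃ f : Fin n → Fin Q.nE,
      op (List.ofFn fun i => arrA k Q Rel (f i)).prod • x ≠ 0 := by
    intro n
    induction n with
    | zero => intro x hx; exact ⟨Fin.elim0, by simpa using hx⟩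
    | succ n ih =>
      intro x hx
      obtain ⟨a, ha⟩ := hcon x hx
      obtain ⟨f, hf⟩ := ih _ ha
      refine ⟨Fin.cons a f, ?_⟩
      simpa [List.ofFn_succ, mul_smul] using hf
  obtain ⟨x, hx⟩ := exists_ne (0 : M)
  obtain ⟨f, hf⟩ := key m x hx
  refine hf ?_
  have h0 := hm f
  rw [inI, map_list_prod, List.map_ofFn] at h0
  have h1 : (List.ofFn fun i => arrA k Q Rel (f i)).prod = 0 := h0
  rw [h1, op_zero, zero_smul]

theorem exists_annihilated_vtx (hg : IsGentle k Q Rel) [Nontrivial M] :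
    ∃ (v : Fin Q.nV) (m : M), m ≠ 0 ∧ op (vtxA k Q Rel v) • m = m ∧
      ∀ a, op (arrA k Q Rel a) • m = 0 := by
  obtain ⟨m, hm, ha⟩ := exists_annihilated (M := M) hg
  have hex : ∃ v, op (vtxA k Q Rel v) • m ≠ 0 := by
    by_contra! hcon
    refine hm ?_
    rw [← one_smul (GAlg k Q Rel)ᵐᵒᵖ m, ← op_one, ← sum_vtxA, Finset.op_sum, Finset.sum_smul]
    exact Finset.sum_eq_zero fun v _ => hcon v
  obtain ⟨v, hv⟩ := hex
  refine ⟨v, _, hv, by rw [smul_smul, ← op_mul, vtxA_mul_self], fun a => ?_⟩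
  rw [smul_smul, ← op_mul]
  by_cases h : v = Q.src a
  · rw [h, vtxA_mul_arrA, ha]
  · rw [vtxA_mul_arrA_of_ne h, op_zero, zero_smul]

theorem pdLT_of_isSimpleModule (hg : IsGentle k Q Rel) {n : ℕ}
    (h : ∀ a, PdLT (GAlg k Q Rel)ᵐᵒᵖ (rIdeal (GAlg k Q Rel) (arrA k Q Rel a)) n)
    [IsSimpleModule (GAlg k Q Rel)ᵐᵒᵖ M] : PdLT (GAlg k Q Rel)ᵐᵒᵖ M (n + 1) := by
  have := IsSimpleModule.nontrivial (GAlg k Q Rel)ᵐᵒᵖ M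
  obtain ⟨v, m, hm, hmv, hma⟩ := exists_annihilated_vtx (M := M) hg
  let g : rIdeal (GAlg k Q Rel) (vtxA k Q Rel v) →ₗ[(GAlg k Q Rel)ᵐᵒᵖ] M :=
    { toFun := fun x => op x.1 • m
      map_add' := fun x y => add_smul (op x.1) (op y.1) m
      map_smul' := fun r x => mul_smul r (op x.1) m }
  have hgx : ∀ x, g x = op x.1 • m := fun x => rfl
  have hrad : ∀ x ∈ vtxRad k Rel v, op x • m = 0 := by
    have : vtxRad k Rel v ≤ LinearMap.ker ((LinearMap.toSpanSingleton (GAlg k Q Rel)ᵐᵒᵖ M m).comp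
        (opLinearEquiv (GAlg k Q Rel)ᵐᵒᵖ).toLinearMap) := by
      refine Finset.sup_le fun a _ => ?_
      intro y hy
      obtain ⟨z, rfl⟩ := mem_rIdeal.1 hy
      change op (arrA k Q Rel a * z) • m = 0
      rw [op_mul, mul_smul, hma, smul_zero]
    exact fun x hx => this hx
  have hle : vtxRad k Rel v ≤ rIdeal (GAlg k Q Rel) (vtxA k Q Rel v) := by
    refine Finset.sup_le fun a ha => ?_
    intro y hy
    obtain ⟨z, rfl⟩ := mem_rIdeal.1 hy
    rw [mem_rIdeal_vtxA, ← (Finset.mem_filter.1 ha).2, ← mul_assoc, vtxA_mul_arrA]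
  refine PdLT.of_surjective (g := g) ?_
    ((PdLT.finset_sup (iSupIndep_rIdeal_arrA hg) h _).of_equiv
    ((Submodule.submoduleOfEquivOfLe hle).symm.trans (LinearEquiv.ofEq _ _ ?_)))
  · refine LinearMap.surjective_of_ne_zero fun h0 => hm ?_
    rw [← hmv]
    exact LinearMap.congr_fun h0 ⟨_, mem_rIdeal_vtxA.2 (vtxA_mul_self v)⟩
  · ext ⟨x, hx⟩
    rw [LinearMap.mem_ker, Submodule.submoduleOf, Submodule.mem_comap, hgx]
    change x ∈ vtxRad k Rel v ↔ _
    refine ⟨hrad x, fun h0 => ?_⟩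
    obtain ⟨c, r, hr, hc⟩ := exists_vtxA_mul_eq v x
    rw [mem_rIdeal_vtxA.1 hx] at hc
    rcases eq_or_ne c 0 with rfl | hc0
    · rwa [hc, zero_smul, zero_add]
    · refine absurd ?_ hm
      change op x • m = 0 at h0
      rw [hc, op_add, add_smul, hrad r hr, add_zero, Algebra.smul_def, Algebra.commutes, op_mul,
        mul_smul, hmv] at h0
      rw [← one_smul (GAlg k Q Rel)ᵐᵒᵖ m, ← op_one, ← map_one (algebraMap k _),
        ← mul_inv_cancel₀ hc0, map_mul, op_mul, mul_smul, h0, smul_zero]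

end Modules

end ProjectiveResolutions

section ClosedWalks

variable {Q : QuiverData}

theorem UCycle.edgeSet_nonempty (C : UCycle Q) : C.edgeSet.Nonempty :=
  ⟨_, 0, C.len1, rfl⟩

theorem QuiverData.reachable_of_walk {c : ℕ → Fin Q.nE}
    (hc : ∀ i, Q.tgt (c i) = Q.src (c (i + 1))) (i n : ℕ) :
    (Q.graphOn (c '' Set.Ico i (i + n))).Reachable (Q.src (c i)) (Q.src (c (i + n))) := by
  induction n with
  | zero => exact .refl _
  | succ n ih =>
    refine (ih.mono (graphOn_mono (Set.image_mono (Set.Ico_subset_Ico_right (by omega))))).trans ?_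
    refine Joins.reachable (b := c (i + n))
      (Set.mem_image_of_mem c (Set.mem_Ico.2 ⟨by omega, by omega⟩)) ?_
    rw [← add_assoc, ← hc]
    exact Q.joins_src_tgt _

theorem QuiverData.exists_uCycle_of_directed_walk {c : ℕ → Fin Q.nE}
    (hc : ∀ i, Q.tgt (c i) = Q.src (c (i + 1))) {i n : ℕ}
    (hcl : Q.tgt (c (i + n)) = Q.src (c i)) (hn : c (i + n) ∉ c '' Set.Ico i (i + n)) :
    ∃ C : UCycle Q, C.edgeSet ⊆ c '' Set.Icc i (i + n) := by
  obtain ⟨C, -, hC⟩ := exists_uCycle_of_reachable (Q.reachable_of_walk hc i n) hn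
    (hcl ▸ Q.joins_src_tgt _)
  refine ⟨C, hC.trans (Set.insert_subset ⟨_, ⟨by omega, le_rfl⟩, rfl⟩
    (Set.image_mono Set.Ico_subset_Icc_self))⟩

theorem OneCycle.injOn_src_of_walk (h1 : OneCycle Q) {c : ℕ → Fin Q.nE} {l : ℕ}
    (hc : ∀ i, Q.tgt (c i) = Q.src (c (i + 1))) (hl : ∀ i, c (i + l) = c i)
    (hinj : ∀ i j, c i = c j → i ≡ j [MOD l]) :
    Set.InjOn (fun i => Q.src (c i)) (Set.Iio l) := by
  have key : ∀ i j, i < j → j < l → Q.src (c i) ≠ Q.src (c j) := by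
    intro i j hij hjl hs
    have hI : Set.InjOn c (Set.Ico i (i + l)) := by
      intro a ha b hb hab
      refine Nat.ModEq.eq_of_abs_lt (hinj a b hab) ?_
      rw [abs_lt]
      obtain ⟨h1, h2⟩ := ha
      obtain ⟨h3, h4⟩ := hb
      omega
    obtain ⟨m, rfl⟩ : ∃ m, j = i + m + 1 := ⟨j - i - 1, by omega⟩
    obtain ⟨n, hn⟩ : ∃ n, i + l = i + m + 1 + n + 1 := ⟨l - m - 2, by omega⟩
    have hnot : ∀ a b, i ≤ a → b < i + l → c b ∉ c '' Set.Ico a b := by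
      rintro a b ha hb ⟨x, ⟨hx, hx'⟩, hxb⟩
      exact hx'.ne (hI ⟨ha.trans hx, by omega⟩ ⟨by omega, hb⟩ hxb)
    obtain ⟨C, hC⟩ := Q.exists_uCycle_of_directed_walk hc (i := i) (n := m) (by rw [hc, hs])
      (hnot _ _ le_rfl (by omega))
    obtain ⟨C', hC'⟩ := Q.exists_uCycle_of_directed_walk hc (i := i + m + 1) (n := n)
      (by rw [hc, ← hn, hl, hs]) (hnot _ _ (by omega) (by omega))
    obtain ⟨a, ha⟩ := C.edgeSet_nonempty
    obtain ⟨x, ⟨hx1, hx2⟩, rfl⟩ := hC ha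
    obtain ⟨y, ⟨hy1, hy2⟩, hyx⟩ := hC' (h1.2 C C' ▸ ha)
    have := hI ⟨by omega, by omega⟩ ⟨by omega, by omega⟩ hyx
    omega
  intro i hi j hj hij
  rcases lt_trichotomy i j with h | h | h
  · exact absurd hij (key i j h hj)
  · exact h
  · exact absurd hij.symm (key j i h hi)

end ClosedWalks

section CompleteResolutions

variable {k : Type} [Field k] {Q : QuiverData} {Rel : Set (Fin Q.nE × Fin Q.nE)}

theorem nonempty_frCycle (hg : IsGentle k Q Rel) (hns : NoShortFRC k Q Rel) (h1 : OneCycle Q)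
    {s : Set (Fin Q.nE)} (hs : s.Nonempty) (h : ∀ a ∈ s, ∃ d ∈ s, (a, d) ∈ Rel) :
    Nonempty (FRCycle k Q Rel) := by
  choose! f hf hrel using h
  let σ : s → s := fun a => ⟨f a, hf a a.2⟩
  have hσ : Function.Injective σ := fun a b hab => Subtype.ext <| by
    have ha := hrel a a.2
    have hb := hrel b b.2
    have hab : f a = f b := congrArg Subtype.val hab
    rw [← hab] at hb
    exact hg.uniq_rel_left _ _ _ (hg.comp_rel _ ha) (hg.comp_rel _ hb) (inI_of_mem ha)
      (inI_of_mem hb)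
  obtain ⟨a, ha⟩ := hs
  let x : s := ⟨a, ha⟩
  let c : ℕ → Fin Q.nE := fun i => (σ^[i] x).1
  let l := Function.minimalPeriod σ x
  have hl : 0 < l := Function.minimalPeriod_pos_of_mem_periodicPts (hσ.mem_periodicPts x)
  have hcr : ∀ i, (c i, c (i + 1)) ∈ Rel := fun i => by
    simp only [c, Function.iterate_succ_apply']
    exact hrel _ (σ^[i] x).2
  have hcl : ∀ i, c (i + l) = c i := fun i =>
    congrArg Subtype.val (Function.iterate_add_minimalPeriod_eq (f := σ) (x := x))
  have hcomp : ∀ i, Q.tgt (c i) = Q.src (c (i + 1)) := fun i => hg.comp_rel _ (hcr i)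
  have hinj : ∀ i j, c i = c j → i ≡ j [MOD l] := fun i j hij => by
    have hij : σ^[i] x = σ^[j] x := Subtype.ext hij
    rw [← Function.iterate_mod_minimalPeriod_eq (n := i),
      ← Function.iterate_mod_minimalPeriod_eq (n := j)] at hij
    exact Function.iterate_injOn_Iio_minimalPeriod (Nat.mod_lt _ hl) (Nat.mod_lt _ hl) hij
  have hfrel := fun i => inI_of_mem (k := k) (hcr i)
  exact ⟨⟨l, hns l c hl hcl hcomp hfrel, c, hcl, hcomp, hfrel, fun i j hi hj hij =>
    h1.injOn_src_of_walk hcomp hcl hinj hi hj hij⟩⟩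

theorem exists_pdLT (hg : IsGentle k Q Rel) [Module.Finite k (GAlg k Q Rel)]
    (h : ∀ a, ∃ n, PdLT (GAlg k Q Rel)ᵐᵒᵖ (rIdeal (GAlg k Q Rel) (arrA k Q Rel a)) n) :
    ∃ n, ∀ (M : Type) [AddCommGroup M] [Module (GAlg k Q Rel)ᵐᵒᵖ M],
      Module.Finite (GAlg k Q Rel)ᵐᵒᵖ M → PdLT (GAlg k Q Rel)ᵐᵒᵖ M n := by
  choose n hn using h
  refine ⟨Finset.univ.sup n + 1, fun M _ _ hM => PdLT.of_isFiniteLength (fun M _ _ _ =>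
    pdLT_of_isSimpleModule hg fun a => (hn a).mono (Finset.le_sup (Finset.mem_univ a))) ?_⟩
  have := IsArtinianRing.of_finite k (GAlg k Q Rel)ᵐᵒᵖ
  exact isFiniteLength_iff_isNoetherian_isArtinian.2 ⟨inferInstance, inferInstance⟩

theorem IsGProjMod.projective {R : Type} [Ring R] {M : Type} [AddCommGroup M] [Module Rᵐᵒᵖ M]
    (hM : IsGProjMod R M) {n : ℕ} (h : ∀ (M : Type) [AddCommGroup M] [Module Rᵐᵒᵖ M],
      Module.Finite Rᵐᵒᵖ M → PdLT Rᵐᵒᵖ M n) : Module.Projective Rᵐᵒᵖ M := by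
  obtain ⟨P, d, hfin, hproj, hex, -, ⟨e⟩⟩ := hM
  have := PdLT.projective_range d hex (fun j => h _ inferInstance) (-1)
  exact Module.Projective.of_equiv e.symm

theorem nonempty_frCycle_of_isNPIGProj (hg : IsGentle k Q Rel) [Module.Finite k (GAlg k Q Rel)]
    (hns : NoShortFRC k Q Rel) (h1 : OneCycle Q) {M : Type} [AddCommGroup M]
    [Module (GAlg k Q Rel)ᵐᵒᵖ M] (hM : IsNPIGProj (GAlg k Q Rel) M) :
    Nonempty (FRCycle k Q Rel) := by
  refine nonempty_frCycle hg hns h1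
    (s := {a | ∀ n, ¬ PdLT (GAlg k Q Rel)ᵐᵒᵖ (rIdeal (GAlg k Q Rel) (arrA k Q Rel a)) n}) ?_
    fun a ha => (exists_rel_of_not_pdLT hg ha).imp fun d hd => hd.symm
  by_contra hne
  refine hM.2.2 ?_
  obtain ⟨n, hn⟩ := exists_pdLT hg fun a => by
    by_contra! ha
    exact hne ⟨a, ha⟩
  exact hM.1.projective hn

end CompleteResolutions

/-- Remark `rmk: rmk of main 2` (1).  Let `A = kQ/I` be a
gentle one-cycle algebra.  If `A` admits at least one (finitely generated)
non-projective indecomposable Gorenstein projective right module, then `A` is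
representation-finite. -/
theorem stmt13 (k : Type) [Field k] [IsAlgClosed k] (Q : QuiverData)
    (Rel : Set (Fin Q.nE × Fin Q.nE)) (hgentle : IsGentle k Q Rel)
    (hfd : Module.Finite k (GAlg k Q Rel)) (hns : NoShortFRC k Q Rel)
    (honecycle : OneCycle Q)
    (hex : ∃ N : ModuleCat.{0} (GAlg k Q Rel)ᵐᵒᵖ,
      Module.Finite (GAlg k Q Rel)ᵐᵒᵖ N ∧ IsNPIGProj (GAlg k Q Rel) N) :
    RepFinite (GAlg k Q Rel)ᵐᵒᵖ := by
  obtain ⟨N, -, hN⟩ := hex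
  obtain ⟨C⟩ := nonempty_frCycle_of_isNPIGProj hgentle hns honecycle hN
  exact repFinite_of_frCycle hgentle C honecycle
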